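/- Let A, B be N×N complex matrices with B invertible, let λ, μ be partitions with at most N parts, and let q ≥ 1 be an integer. Then ∫_{U(N)} s_λ(UA) s_μ(U† B) (det U)^{−q} d_*U = δ_{λ, μ+q^N} · (s_λ(AB)/s_λ(I_N)) · (det B)^{−q}, i.e. the integral vanishes unless λ = μ + q^N, in which case it equals (det B)^{−q} s_λ(AB)/s_λ(I_N). -/

import Mathlib

open scoped BigOperators Classical
open MeasureTheory Matrix

noncomputable section

/-- Complete homogeneous symmetric functions of the eigenvalues of `X`, defined through
Newton's identities from the power sums `p_m = Tr(X^m)`. -/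
def hMat {N : ℕ} (X : Matrix (Fin N) (Fin N) ℂ) : ℕ → ℂ
  | 0 => 1
  | (k+1) => ((k : ℂ) + 1)⁻¹ *
      ∑ m ∈ Finset.range (k+1), (X ^ (m+1)).trace * hMat X (k - m)
  termination_by k => k
  decreasing_by exact Nat.lt_succ_of_le (Nat.sub_le _ _)

def hMatZ {N : ℕ} (X : Matrix (Fin N) (Fin N) ℂ) (k : ℤ) : ℂ :=
  if k < 0 then 0 else hMat X k.toNat

/-- The Schur polynomial `s_λ(X)` of an `N×N` complex matrix `X`, evaluated at the
eigenvalues of `X`, via the Jacobi-Trudi formula `s_λ = det(h_{λ_i - i + j})`.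
Here `l : Fin N → ℕ` lists the (at most `N`) parts of the partition `λ`. -/
def schur {N : ℕ} (l : Fin N → ℕ) (X : Matrix (Fin N) (Fin N) ℂ) : ℂ :=
  (Matrix.of fun i j : Fin N => hMatZ X ((l i : ℤ) - (i : ℤ) + (j : ℤ))).det

/-- Partitions with at most `N` parts (weakly decreasing functions `Fin N → ℕ`). -/
def PartitionN (N : ℕ) := {l : Fin N → ℕ // Antitone l}

/-- The unitary group `U(N)`. -/
abbrev UN (N : ℕ) := Matrix.unitaryGroup (Fin N) ℂ

instance (N : ℕ) : MeasurableSpace (UN N) := borel _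

/-! ### Jacobi–Trudi determinants and alternants -/

/-- Generating function of the complete homogeneous symmetric functions, from Newton's identities. -/
theorem mk_mul_prod_one_sub {K : Type*} [CommRing K] [IsAddTorsionFree K] {N : ℕ}
    (x : Fin N → K) (h : ℕ → K) (h0 : h 0 = 1)
    (hs : ∀ k : ℕ, ((k : K) + 1) * h (k + 1) =
      ∑ m ∈ Finset.range (k + 1), (∑ i, x i ^ (m + 1)) * h (k - m)) :
    PowerSeries.mk h * ∏ i, (1 - PowerSeries.C (x i) * PowerSeries.X) = 1 := by
  have hgeo : ∀ i, PowerSeries.mk (fun k => x i ^ k) *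
      (1 - PowerSeries.C (x i) * PowerSeries.X) = 1 := by
    intro i
    ext n
    rw [mul_sub, mul_one, map_sub, ← mul_assoc, mul_comm _ (PowerSeries.C (x i)), mul_assoc,
      PowerSeries.coeff_C_mul]
    cases n with
    | zero => simp
    | succ n =>
      rw [PowerSeries.coeff_succ_mul_X]
      simp [PowerSeries.coeff_one, pow_succ']
  have hH : PowerSeries.derivative K (PowerSeries.mk h) =
      (∑ i, PowerSeries.C (x i) * PowerSeries.mk (fun k => x i ^ k)) * PowerSeries.mk h := by
    ext n
    rw [PowerSeries.coeff_derivative, PowerSeries.coeff_mk, PowerSeries.coeff_mul,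
      Finset.Nat.sum_antidiagonal_eq_sum_range_succ_mk, mul_comm, hs]
    refine Finset.sum_congr rfl fun m _ => ?_
    simp [PowerSeries.coeff_mk, pow_succ', map_sum]
  have hE : ∀ s : Finset (Fin N), PowerSeries.derivative K
      (∏ i ∈ s, (1 - PowerSeries.C (x i) * PowerSeries.X)) =
      -((∑ i ∈ s, PowerSeries.C (x i) * PowerSeries.mk (fun k => x i ^ k)) *
        ∏ i ∈ s, (1 - PowerSeries.C (x i) * PowerSeries.X)) := by
    intro s
    induction s using Finset.induction_on with
    | empty => simp
    | insert a s ha ih =>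
      rw [Finset.prod_insert ha, Finset.sum_insert ha, Derivation.leibniz, ih]
      have : PowerSeries.derivative K (1 - PowerSeries.C (x a) * PowerSeries.X) =
          -PowerSeries.C (x a) := by
        simp [Derivation.leibniz]
      rw [this]
      simp only [smul_eq_mul]
      linear_combination (PowerSeries.C (x a) *
        ∏ i ∈ s, (1 - PowerSeries.C (x i) * PowerSeries.X)) * hgeo a
  apply PowerSeries.derivative.ext
  · rw [Derivation.leibniz, hE, hH]
    simp only [smul_eq_mul, PowerSeries.derivative_one]
    ring
  · simp [map_prod, h0]

/-- Extension of a sequence by zero to negative indices. -/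
def extendZero {K : Type*} [Zero K] (h : ℕ → K) (k : ℤ) : K := if k < 0 then 0 else h k.toNat

/-- The Jacobi–Trudi determinant attached to shifted exponents `α = λ + ρ`. -/
def jacobiTrudi {K : Type*} [CommRing K] {N : ℕ} (h : ℕ → K) (α : Fin N → ℕ) : K :=
  (Matrix.of fun i j : Fin N => extendZero h ((α i : ℤ) - (N - 1) + j)).det

/-- The staircase `(N-1, …, 1, 0)`. -/
def stair (N : ℕ) (i : Fin N) : ℕ := N - 1 - i

theorem stair_cast {N : ℕ} (i : Fin N) : (stair N i : ℤ) = N - 1 - i := by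
  have := i.2
  unfold stair
  omega

theorem jacobiTrudi_stair {K : Type*} [CommRing K] {N : ℕ} (h : ℕ → K) (h0 : h 0 = 1) :
    jacobiTrudi h (stair N) = 1 := by
  unfold jacobiTrudi
  rw [Matrix.det_of_isUpperTriangular]
  · refine Finset.prod_eq_one fun i _ => ?_
    have : ((stair N i : ℤ) - (N - 1) + i) = 0 := by rw [stair_cast]; ring
    simp [this, extendZero, h0]
  · intro i j hij
    have hij : j < i := hij
    have : ((stair N i : ℤ) - (N - 1) + j) < 0 := by
      rw [stair_cast]
      have : (j : ℕ) < i := hij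
      omega
    simp [extendZero, this]

/-- The alternant `det (x_j ^ α_i)`. -/
def alternant {K : Type*} [CommRing K] {N : ℕ} (x : Fin N → K) (α : Fin N → ℕ) : K :=
  (Matrix.of fun i j : Fin N => x j ^ α i).det

theorem jacobiTrudi_mul_alternant {K : Type*} [CommRing K] [IsAddTorsionFree K] {N : ℕ}
    (x : Fin N → K) (h : ℕ → K) (h0 : h 0 = 1)
    (hs : ∀ k : ℕ, ((k : K) + 1) * h (k + 1) =
      ∑ m ∈ Finset.range (k + 1), (∑ i, x i ^ (m + 1)) * h (k - m)) (α : Fin N → ℕ) :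
    jacobiTrudi h α * alternant x (stair N) = alternant x α := by
  set W : Fin N → Polynomial K := fun k =>
    ∏ i ∈ Finset.univ.erase k, (1 - Polynomial.C (x i) * Polynomial.X) with hW
  have hdeg : ∀ k, (W k).natDegree ≤ N - 1 := by
    intro k
    refine (Polynomial.natDegree_prod_le _ _).trans ?_
    refine (Finset.sum_le_card_nsmul _ _ 1 fun i _ => ?_).trans ?_
    · compute_degree
    · simp
  have key : ∀ (n : ℕ) (k : Fin N),
      ∑ j : Fin N, extendZero h ((n : ℤ) - (N - 1) + j) * (W k).coeff (N - 1 - j) = x k ^ n := by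
    intro n k
    have h1 : PowerSeries.mk h * (W k : PowerSeries K) = PowerSeries.mk (fun n => x k ^ n) := by
      have e := mk_mul_prod_one_sub x h h0 hs
      rw [← Finset.mul_prod_erase _ _ (Finset.mem_univ k)] at e
      have hWk : (W k : PowerSeries K) =
          ∏ i ∈ Finset.univ.erase k, (1 - PowerSeries.C (x i) * PowerSeries.X) := by
        simp only [hW]
        rw [← Polynomial.coeToPowerSeries.ringHom_apply, map_prod]
        simp
      rw [hWk]
      have hgeo : PowerSeries.mk (fun n => x k ^ n) *
          (1 - PowerSeries.C (x k) * PowerSeries.X) = 1 := by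
        ext n
        rw [mul_sub, mul_one, map_sub, ← mul_assoc, mul_comm _ (PowerSeries.C (x k)), mul_assoc,
          PowerSeries.coeff_C_mul]
        cases n with
        | zero => simp
        | succ n =>
          rw [PowerSeries.coeff_succ_mul_X]
          simp [PowerSeries.coeff_one, pow_succ']
      calc _ = (PowerSeries.mk h * ∏ i ∈ Finset.univ.erase k,
              (1 - PowerSeries.C (x i) * PowerSeries.X)) * (PowerSeries.mk (fun n => x k ^ n) *
              (1 - PowerSeries.C (x k) * PowerSeries.X)) := by rw [hgeo, mul_one]
        _ = PowerSeries.mk (fun n => x k ^ n) := by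
          linear_combination (PowerSeries.mk (fun n => x k ^ n)) * e
    have h2 := congrArg (PowerSeries.coeff n) h1
    rw [PowerSeries.coeff_mk, mul_comm, PowerSeries.coeff_mul,
      Finset.Nat.sum_antidiagonal_eq_sum_range_succ_mk] at h2
    simp only [PowerSeries.coeff_mk, Polynomial.coeff_coe] at h2
    rw [← h2]
    have e1 : ∑ b ∈ Finset.range (n + 1), (W k).coeff b * h (n - b) =
        ∑ b ∈ Finset.range (n + 1), (W k).coeff b * extendZero h ((n : ℤ) - b) := by
      refine Finset.sum_congr rfl fun b hb => ?_
      have hb := Finset.mem_range.1 hb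
      have : ¬ ((n : ℤ) - b < 0) := by omega
      have e : ((n : ℤ) - b).toNat = n - b := by omega
      simp [extendZero, this, e]
    have e2 : ∑ b ∈ Finset.range (n + 1), (W k).coeff b * extendZero h ((n : ℤ) - b) =
        ∑ b ∈ Finset.range (max (n + 1) N), (W k).coeff b * extendZero h ((n : ℤ) - b) := by
      refine Finset.sum_subset (by simp) fun b _ hb => ?_
      have : ((n : ℤ) - b < 0) := by simp at hb; omega
      simp [extendZero, this]
    have e3 : ∑ b ∈ Finset.range N, (W k).coeff b * extendZero h ((n : ℤ) - b) =
        ∑ b ∈ Finset.range (max (n + 1) N), (W k).coeff b * extendZero h ((n : ℤ) - b) := by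
      refine Finset.sum_subset (by simp) fun b _ hb => ?_
      have hk := k.2
      have : (W k).natDegree < b := by
        have := hdeg k
        simp at hb; omega
      simp [Polynomial.coeff_eq_zero_of_natDegree_lt this]
    rw [e1, e2, ← e3, ← Finset.sum_range_reflect, Finset.sum_range]
    refine Finset.sum_congr rfl fun j _ => ?_
    have hj := j.2
    have : ((n : ℤ) - (N - 1) + j) = (n : ℤ) - ((N - 1 - j : ℕ) : ℤ) := by omega
    rw [this, mul_comm]
  have main : ∀ β : Fin N → ℕ, jacobiTrudi h β *
      (Matrix.of fun j k : Fin N => (W k).coeff (N - 1 - j)).det = alternant x β := by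
    intro β
    unfold jacobiTrudi alternant
    rw [← Matrix.det_mul]
    congr 1
    ext i k
    simp only [Matrix.mul_apply, Matrix.of_apply]
    exact key (β i) k
  have := main (stair N)
  rw [jacobiTrudi_stair h h0, one_mul] at this
  rw [← this, main]

theorem schur_eq_jacobiTrudi {N : ℕ} (l : Fin N → ℕ) (X : Matrix (Fin N) (Fin N) ℂ) :
    schur l X = jacobiTrudi (hMat X) (fun i => l i + stair N i) := by
  unfold schur jacobiTrudi
  congr 1
  ext i j
  simp only [Matrix.of_apply]
  have : (((l i + stair N i : ℕ) : ℤ) - (N - 1) + j) = (l i : ℤ) - i + j := by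
    push_cast
    rw [stair_cast]
    ring
  rw [this]
  rfl

theorem map_jacobiTrudi {K K' : Type*} [CommRing K] [CommRing K'] {N : ℕ} (φ : K →+* K')
    (h : ℕ → K) (α : Fin N → ℕ) : φ (jacobiTrudi h α) = jacobiTrudi (fun k => φ (h k)) α := by
  unfold jacobiTrudi
  rw [RingHom.map_det]
  congr 1
  ext i j
  simp only [RingHom.mapMatrix_apply, Matrix.map_apply, Matrix.of_apply, extendZero]
  split_ifs <;> simp

/-! ### Alternating polynomials -/

/-- The monomial `∏ x_i ^ β_i`. -/
def expMonomial {N : ℕ} (β : Fin N → ℕ) : MvPolynomial (Fin N) ℂ :=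
  MvPolynomial.monomial (Finsupp.equivFunOnFinite.symm β) 1

theorem expMonomial_eq_prod {N : ℕ} (β : Fin N → ℕ) :
    expMonomial β = ∏ i, MvPolynomial.X i ^ β i := by
  rw [expMonomial, MvPolynomial.monomial_eq, Finsupp.prod_fintype]
  · simp
  · simp

theorem expMonomial_mul {N : ℕ} (β γ : Fin N → ℕ) :
    expMonomial β * expMonomial γ = expMonomial (β + γ) := by
  simp [expMonomial_eq_prod, pow_add, Finset.prod_mul_distrib]

/-- The alternant as a polynomial. -/
def altPoly {N : ℕ} (α : Fin N → ℕ) : MvPolynomial (Fin N) ℂ := alternant MvPolynomial.X α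

theorem altPoly_eq_sum {N : ℕ} (α : Fin N → ℕ) :
    altPoly α = ∑ σ : Equiv.Perm (Fin N),
      MvPolynomial.C ((Equiv.Perm.sign σ : ℤ) : ℂ) * expMonomial (α ∘ σ) := by
  unfold altPoly alternant
  rw [Matrix.det_apply']
  refine Finset.sum_congr rfl fun σ _ => ?_
  simp [expMonomial_eq_prod]

theorem coeff_altPoly {N : ℕ} (α β : Fin N → ℕ) :
    (altPoly α).coeff (Finsupp.equivFunOnFinite.symm β) =
      ∑ σ : Equiv.Perm (Fin N), if β = α ∘ σ then ((Equiv.Perm.sign σ : ℤ) : ℂ) else 0 := by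
  rw [altPoly_eq_sum, MvPolynomial.coeff_sum]
  refine Finset.sum_congr rfl fun σ _ => ?_
  rw [MvPolynomial.coeff_C_mul, expMonomial, MvPolynomial.coeff_monomial]
  simp [eq_comm]

theorem perm_eq_one_of_strictAnti {N : ℕ} {α : Fin N → ℕ} {σ : Equiv.Perm (Fin N)}
    (h1 : StrictAnti α) (h2 : StrictAnti (α ∘ σ)) : σ = 1 := by
  have : StrictMono σ := fun i j hij => h1.lt_iff_gt.1 (h2 hij)
  have := (this.range_inj strictMono_id).1 (by simp)
  exact Equiv.ext fun i => congrFun this i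

theorem coeff_altPoly_of_strictAnti {N : ℕ} {α β : Fin N → ℕ} (hα : StrictAnti α)
    (hβ : StrictAnti β) :
    (altPoly α).coeff (Finsupp.equivFunOnFinite.symm β) = if β = α then 1 else 0 := by
  rw [coeff_altPoly, Finset.sum_eq_single 1]
  · simp
  · intro σ _ hσ
    rw [if_neg]
    rintro rfl
    exact hσ (perm_eq_one_of_strictAnti hα hβ)
  · simp

theorem strictAnti_stair (N : ℕ) : StrictAnti (stair N) := by
  intro i j hij
  have h : (i : ℕ) < j := hij
  have := j.2
  unfold stair
  omega

theorem strictAnti_stair_add {N : ℕ} {l : Fin N → ℕ} (hl : Antitone l) :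
    StrictAnti (stair N + l) := fun _ _ h =>
  add_lt_add_of_lt_of_le (strictAnti_stair N h) (hl h.le)

theorem altPoly_stair_ne_zero (N : ℕ) : altPoly (stair N) ≠ 0 := by
  intro h
  have := coeff_altPoly_of_strictAnti (strictAnti_stair N) (strictAnti_stair N)
  simp [h] at this

theorem altPoly_eq_zero {N : ℕ} {α : Fin N → ℕ} (h : ¬ Function.Injective α) :
    altPoly α = 0 := by
  unfold Function.Injective at h
  push Not at h
  obtain ⟨i, j, hij, hne⟩ := h
  exact Matrix.det_zero_of_row_eq hne (by ext; simp [hij])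

theorem altPoly_comp_perm {N : ℕ} (α : Fin N → ℕ) (σ : Equiv.Perm (Fin N)) :
    altPoly (α ∘ σ) = MvPolynomial.C ((Equiv.Perm.sign σ : ℤ) : ℂ) * altPoly α := by
  have := Matrix.det_permute σ
    (Matrix.of fun i j : Fin N => (MvPolynomial.X j : MvPolynomial (Fin N) ℂ) ^ α i)
  unfold altPoly alternant
  rw [show MvPolynomial.C ((Equiv.Perm.sign σ : ℤ) : ℂ) =
    ((Equiv.Perm.sign σ : ℤ) : MvPolynomial (Fin N) ℂ) by simp, ← this]
  rfl

/-- Multiplication of an alternant by a symmetric polynomial. -/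
theorem symmetric_mul_altPoly {N : ℕ} {Q : MvPolynomial (Fin N) ℂ} (hQ : Q.IsSymmetric)
    (α : Fin N → ℕ) :
    Q * altPoly α = ∑ β ∈ Q.support, MvPolynomial.C (Q.coeff β) * altPoly (α + ⇑β) := by
  have hσ : ∀ σ : Equiv.Perm (Fin N),
      Q = ∑ β ∈ Q.support, MvPolynomial.C (Q.coeff β) * expMonomial (β ∘ σ) := by
    intro σ
    have h := hQ σ⁻¹
    conv_lhs => rw [← h, Q.as_sum]
    rw [map_sum]
    refine Finset.sum_congr rfl fun β _ => ?_
    rw [MvPolynomial.rename_monomial, expMonomial, MvPolynomial.C_mul_monomial, mul_one]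
    congr 2
    ext i
    rw [show i = (σ⁻¹ : Equiv.Perm (Fin N)) (σ i) by simp,
      Finsupp.mapDomain_apply (Equiv.injective _)]
    simp
  simp_rw [altPoly_eq_sum, Finset.mul_sum]
  rw [Finset.sum_comm]
  refine Finset.sum_congr rfl fun σ _ => ?_
  conv_lhs => rw [hσ σ]
  rw [Finset.sum_mul]
  refine Finset.sum_congr rfl fun β _ => ?_
  have : (α + ⇑β) ∘ σ = β ∘ σ + α ∘ σ := by ext; simp [add_comm]
  rw [this, ← expMonomial_mul]
  ring

/-- The Euler operator `x_i ∂_i`. -/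
def eulerOp {N : ℕ} (i : Fin N) :
    Derivation ℂ (MvPolynomial (Fin N) ℂ) (MvPolynomial (Fin N) ℂ) :=
  (MvPolynomial.X i : MvPolynomial (Fin N) ℂ) • MvPolynomial.pderiv i

theorem eulerOp_X {N : ℕ} (i j : Fin N) :
    eulerOp i (MvPolynomial.X j) = if i = j then MvPolynomial.X j else 0 := by
  simp only [eulerOp, Derivation.smul_apply, MvPolynomial.pderiv_X, smul_eq_mul]
  by_cases h : i = j
  · subst h; simp
  · simp [h, Ne.symm h]

theorem eulerOp_X_pow {N : ℕ} (i j : Fin N) (k : ℕ) :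
    eulerOp i (MvPolynomial.X j ^ k) = if i = j then (k : ℂ) • MvPolynomial.X j ^ k else 0 := by
  rw [Derivation.leibniz_pow, eulerOp_X]
  split_ifs with h
  · cases k with
    | zero => simp
    | succ k =>
      rw [MvPolynomial.smul_eq_C_mul]
      simp [pow_succ]
  · simp

theorem eulerOp_expMonomial {N : ℕ} (i : Fin N) (β : Fin N → ℕ) :
    eulerOp i (expMonomial β) = (β i : ℂ) • expMonomial β := by
  simp only [eulerOp, Derivation.smul_apply, expMonomial, MvPolynomial.pderiv_monomial,
    smul_eq_mul, MvPolynomial.X, MvPolynomial.monomial_mul, MvPolynomial.smul_monomial]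
  rcases Nat.eq_zero_or_pos (β i) with h | h
  · simp [h]
  · have : Finsupp.single i 1 + (Finsupp.equivFunOnFinite.symm β - Finsupp.single i 1) =
        Finsupp.equivFunOnFinite.symm β := by
      ext j
      by_cases hj : i = j
      · subst hj; simp; omega
      · simp [hj]
    rw [this]
    simp

theorem sum_eulerOp_eulerOp_altPoly {N : ℕ} (α : Fin N → ℕ) :
    ∑ i, eulerOp i (eulerOp i (altPoly α)) = (∑ i, (α i : ℂ) ^ 2) • altPoly α := by
  have : ∀ σ : Equiv.Perm (Fin N), ∑ i, (α (σ i) : ℂ) ^ 2 = ∑ i, (α i : ℂ) ^ 2 := fun σ =>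
    Equiv.sum_comp σ (fun i => (α i : ℂ) ^ 2)
  simp only [altPoly_eq_sum, map_sum, Finset.smul_sum, ← MvPolynomial.smul_eq_C_mul,
    Derivation.map_smul, eulerOp_expMonomial]
  rw [Finset.sum_comm]
  refine Finset.sum_congr rfl fun σ _ => ?_
  rw [← Finset.smul_sum, smul_comm, ← this σ, Finset.sum_smul]
  simp only [Function.comp, smul_smul, sq]

theorem derivation_prod_eq {R A ι : Type*} [CommSemiring R] [CommSemiring A] [Algebra R A]
    (D : Derivation R A A) (f g : ι → A) (h : ∀ i, D (f i) = g i * f i) (s : Finset ι) :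
    D (∏ i ∈ s, f i) = (∑ i ∈ s, g i) * ∏ i ∈ s, f i := by
  induction s using Finset.induction_on with
  | empty => simp
  | insert a s ha ih =>
    rw [Finset.prod_insert ha, Finset.sum_insert ha, Derivation.leibniz, ih, h]
    simp only [smul_eq_mul]
    ring

theorem altPoly_stair_eq (N : ℕ) : ∃ c : ℂ, altPoly (stair N) =
    c • ∏ p ∈ (Finset.univ : Finset (Fin N × Fin N)).filter (fun p => p.1 < p.2),
      ((MvPolynomial.X p.2 : MvPolynomial (Fin N) ℂ) - MvPolynomial.X p.1) := by
  have h : altPoly (fun i : Fin N => (i : ℕ)) =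
      ∏ p ∈ (Finset.univ : Finset (Fin N × Fin N)).filter (fun p => p.1 < p.2),
      ((MvPolynomial.X p.2 : MvPolynomial (Fin N) ℂ) - MvPolynomial.X p.1) := by
    have h1 : altPoly (fun i : Fin N => (i : ℕ)) =
        (Matrix.vandermonde (MvPolynomial.X : Fin N → MvPolynomial (Fin N) ℂ)).det := by
      rw [← Matrix.det_transpose]; rfl
    rw [h1, Matrix.det_vandermonde, Finset.prod_filter, ← Finset.univ_product_univ,
      Finset.prod_product]
    refine Finset.prod_congr rfl fun i _ => ?_
    rw [← Finset.prod_filter]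
    refine Finset.prod_congr ?_ fun _ _ => rfl
    ext j; simp
  have h2 : stair N = (fun i : Fin N => (i : ℕ)) ∘ Fin.revPerm := by
    ext i
    simp only [stair, Function.comp, Fin.revPerm_apply, Fin.val_rev]
    omega
  exact ⟨_, by rw [h2, altPoly_comp_perm, h, ← MvPolynomial.smul_eq_C_mul]⟩

theorem sum_eulerOp_altPoly_stair {N : ℕ} (k : ℕ) :
    2 * ∑ i, eulerOp i (altPoly (stair N)) * MvPolynomial.X i ^ k =
      altPoly (stair N) * (∑ a ∈ Finset.range (k + 1),
        (∑ i, MvPolynomial.X i ^ a) * (∑ i, MvPolynomial.X i ^ (k - a)) -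
        ((k : MvPolynomial (Fin N) ℂ) + 1) * ∑ i, MvPolynomial.X i ^ k) := by
  obtain ⟨c, hc⟩ := altPoly_stair_eq N
  set D : Derivation ℂ (MvPolynomial (Fin N) ℂ) (MvPolynomial (Fin N) ℂ) :=
    ∑ i, (MvPolynomial.X i ^ k : MvPolynomial (Fin N) ℂ) • eulerOp i with hD
  have hDa : ∀ F, D F = ∑ i, MvPolynomial.X i ^ k * eulerOp i F := by
    intro F
    rw [hD, ← Derivation.coeFnAddMonoidHom_apply, map_sum, Finset.sum_apply]
    rfl
  have hDX : ∀ j, D (MvPolynomial.X j) = MvPolynomial.X j ^ (k + 1) := by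
    intro j
    rw [hDa]
    simp [eulerOp_X, pow_succ]
  set g : Fin N → Fin N → MvPolynomial (Fin N) ℂ := fun i j =>
    ∑ a ∈ Finset.range (k + 1), MvPolynomial.X i ^ a * MvPolynomial.X j ^ (k - a) with hg
  have hgs : ∀ i j, g i j = g j i := by
    intro i j
    simp only [hg]
    rw [← Finset.sum_range_reflect]
    refine Finset.sum_congr rfl fun a ha => ?_
    have := Finset.mem_range.1 ha
    rw [mul_comm]
    congr 2 <;> omega
  have hgen : ∀ p : Fin N × Fin N, D (MvPolynomial.X p.2 - MvPolynomial.X p.1) =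
      g p.2 p.1 * (MvPolynomial.X p.2 - MvPolynomial.X p.1) := by
    intro p
    rw [map_sub, hDX, hDX, ← geom_sum₂_mul]
    rfl
  have hDV : D (altPoly (stair N)) =
      (∑ p ∈ (Finset.univ : Finset (Fin N × Fin N)).filter (fun p => p.1 < p.2), g p.2 p.1) *
        altPoly (stair N) := by
    rw [hc, Derivation.map_smul, derivation_prod_eq D _ _ hgen, mul_smul_comm]
  have hsum : 2 * ∑ p ∈ (Finset.univ : Finset (Fin N × Fin N)).filter (fun p => p.1 < p.2),
      g p.2 p.1 = ∑ i, ∑ j, g i j - ∑ i, g i i := by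
    have h1 : ∑ p ∈ (Finset.univ : Finset (Fin N × Fin N)).filter (fun p => p.1 < p.2),
        g p.2 p.1 = ∑ i, ∑ j, if i < j then g i j else 0 := by
      rw [Finset.sum_filter, ← Finset.univ_product_univ, Finset.sum_product]
      refine Finset.sum_congr rfl fun i _ => Finset.sum_congr rfl fun j _ => ?_
      simp only [hgs j i]
    have h2 : ∑ p ∈ (Finset.univ : Finset (Fin N × Fin N)).filter (fun p => p.1 < p.2),
        g p.2 p.1 = ∑ i, ∑ j, if j < i then g i j else 0 := by
      rw [h1, Finset.sum_comm]
      refine Finset.sum_congr rfl fun i _ => Finset.sum_congr rfl fun j _ => ?_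
      split_ifs <;> simp [hgs j i]
    have h3 : ∑ i, g i i = ∑ i, ∑ j, if i = j then g i j else 0 := by simp
    rw [two_mul]
    nth_rewrite 1 [h1]
    rw [h2, h3, eq_sub_iff_add_eq, ← Finset.sum_add_distrib, ← Finset.sum_add_distrib]
    refine Finset.sum_congr rfl fun i _ => ?_
    rw [← Finset.sum_add_distrib, ← Finset.sum_add_distrib]
    refine Finset.sum_congr rfl fun j _ => ?_
    rcases lt_trichotomy i j with h | h | h
    · simp [h, h.ne, h.not_gt]
    · simp [h]
    · simp [h, h.ne', h.not_gt]
  have hdiag : ∀ i, g i i = ((k : MvPolynomial (Fin N) ℂ) + 1) * MvPolynomial.X i ^ k := by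
    intro i
    simp only [hg]
    rw [Finset.sum_congr rfl (g := fun _ => MvPolynomial.X i ^ k)]
    · simp
    · intro a ha
      have := Finset.mem_range.1 ha
      rw [← pow_add]; congr 1; omega
  have hall : ∑ i, ∑ j, g i j = ∑ a ∈ Finset.range (k + 1),
        (∑ i, MvPolynomial.X i ^ a) * (∑ i, MvPolynomial.X i ^ (k - a)) := by
    simp only [hg, Finset.sum_mul_sum]
    rw [Finset.sum_comm' (t' := Finset.univ) (s' := fun _ => Finset.univ) (by simp)]
    rw [Finset.sum_comm]
    simp_rw [Finset.sum_comm (s := Finset.univ) (t := Finset.range (k + 1))]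
  calc _ = 2 * D (altPoly (stair N)) := by
        rw [hDa]; simp_rw [mul_comm]
    _ = altPoly (stair N) * (2 * ∑ p ∈ (Finset.univ : Finset (Fin N × Fin N)).filter
          (fun p => p.1 < p.2), g p.2 p.1) := by rw [hDV]; ring
    _ = _ := by
        rw [hsum, hall, Finset.mul_sum]
        simp_rw [hdiag]

/-- Polynomial functions of an `N × N` matrix. -/
abbrev MatPoly (N : ℕ) := MvPolynomial (Fin N × Fin N) ℂ

/-- The generic matrix. -/
def genMat (N : ℕ) : Matrix (Fin N) (Fin N) (MatPoly N) := Matrix.mvPolynomialX (Fin N) (Fin N) ℂ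

theorem genMat_apply {N : ℕ} (a b : Fin N) : genMat N a b = MvPolynomial.X (a, b) := rfl

/-- The derivation `f ↦ (X ↦ d/dt f(X + t E_{ij} X))`. -/
def leftDeriv {N : ℕ} (i j : Fin N) : Derivation ℂ (MatPoly N) (MatPoly N) :=
  MvPolynomial.mkDerivation ℂ (fun p => if p.1 = i then MvPolynomial.X (j, p.2) else 0)

theorem leftDeriv_X {N : ℕ} (i j : Fin N) (p : Fin N × Fin N) :
    leftDeriv i j (MvPolynomial.X p) = if p.1 = i then MvPolynomial.X (j, p.2) else 0 :=
  MvPolynomial.mkDerivation_X ..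

theorem leftDeriv_genMat_pow {N : ℕ} (i j : Fin N) (k : ℕ) (a b : Fin N) :
    leftDeriv i j ((genMat N ^ k) a b) =
      ∑ r ∈ Finset.range k, (genMat N ^ r) a i * (genMat N ^ (k - r)) j b := by
  induction k generalizing a b with
  | zero =>
    by_cases h : a = b
    · subst h; simp
    · simp [h]
  | succ k ih =>
    rw [pow_succ, Matrix.mul_apply, map_sum]
    simp only [Derivation.leibniz, ih, genMat_apply, leftDeriv_X, smul_eq_mul]
    rw [Finset.sum_add_distrib, Finset.sum_range_succ, add_comm]
    congr 1
    · simp only [Finset.mul_sum]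
      rw [Finset.sum_comm]
      refine Finset.sum_congr rfl fun r hr => ?_
      rw [show k + 1 - r = (k - r) + 1 by have := Finset.mem_range.1 hr; omega, pow_succ,
        Matrix.mul_apply, Finset.mul_sum]
      refine Finset.sum_congr rfl fun c _ => ?_
      rw [genMat_apply]; ring
    · simp [Finset.sum_ite_eq', genMat_apply]

/-- The power sums `Tr X^k`. -/
def powerTrace (N k : ℕ) : MatPoly N := (genMat N ^ k).trace

theorem powerTrace_eq_sum (N k : ℕ) : powerTrace N k = ∑ a, (genMat N ^ k) a a := rfl

theorem leftDeriv_powerTrace {N : ℕ} (i j : Fin N) (k : ℕ) :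
    leftDeriv i j (powerTrace N k) = (k : ℂ) • (genMat N ^ k) j i := by
  simp only [powerTrace_eq_sum, map_sum, leftDeriv_genMat_pow]
  rw [Finset.sum_comm, Finset.sum_congr rfl (g := fun _ => (genMat N ^ k) j i)]
  · simp [MvPolynomial.smul_eq_C_mul]
  · intro r hr
    have h : genMat N ^ k = genMat N ^ (k - r) * genMat N ^ r := by
      rw [← pow_add, Nat.sub_add_cancel (Finset.mem_range.1 hr).le]
    rw [h, Matrix.mul_apply]
    exact Finset.sum_congr rfl fun c _ => mul_comm _ _

/-- The quadratic Casimir operator, shifted by a multiple of the Euler operator. -/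
def casimir (N : ℕ) : Module.End ℂ (MatPoly N) :=
  (∑ i, ∑ j, (leftDeriv (N := N) i j : MatPoly N →ₗ[ℂ] MatPoly N) ∘ₗ
    (leftDeriv j i : MatPoly N →ₗ[ℂ] MatPoly N)) +
  ((N : ℂ) - 1) • ∑ i, (leftDeriv (N := N) i i : MatPoly N →ₗ[ℂ] MatPoly N)

theorem casimir_apply {N : ℕ} (f : MatPoly N) :
    casimir N f = ∑ i, ∑ j, leftDeriv i j (leftDeriv j i f) +
      ((N : ℂ) - 1) • ∑ i, leftDeriv i i f := by
  simp [casimir]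

/-- The carré du champ of `casimir`. -/
def carre {N : ℕ} (f g : MatPoly N) : MatPoly N := ∑ i, ∑ j, leftDeriv i j f * leftDeriv j i g

theorem carre_comm {N : ℕ} (f g : MatPoly N) : carre f g = carre g f := by
  unfold carre
  rw [Finset.sum_comm]
  simp only [mul_comm]

theorem casimir_mul {N : ℕ} (f g : MatPoly N) :
    casimir N (f * g) = f * casimir N g + g * casimir N f + 2 * carre f g := by
  have h : 2 * carre f g = carre f g + carre g f := by rw [carre_comm g f]; ring
  rw [h]
  simp only [casimir_apply, carre, Derivation.leibniz, map_add, smul_eq_mul,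
    Finset.mul_sum, mul_add, mul_smul_comm, Finset.smul_sum]
  simp only [← Finset.sum_add_distrib]
  simp only [MvPolynomial.smul_eq_C_mul, Finset.sum_add_distrib, mul_add]
  have hc : ∀ a b : MatPoly N, ∑ i, ∑ j, leftDeriv j i b * leftDeriv i j a =
      ∑ i, ∑ j, leftDeriv i j a * leftDeriv j i b := fun a b => by simp only [mul_comm]
  rw [hc f g, hc g f]
  ring

theorem carre_mul {N : ℕ} (f g h : MatPoly N) :
    carre (f * g) h = f * carre g h + g * carre f h := by
  simp only [carre, Derivation.leibniz, smul_eq_mul, Finset.mul_sum, ← Finset.sum_add_distrib]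
  exact Finset.sum_congr rfl fun i _ => Finset.sum_congr rfl fun j _ => by ring

theorem carre_powerTrace {N : ℕ} (k l : ℕ) :
    carre (powerTrace N k) (powerTrace N l) = ((k : ℂ) * l) • powerTrace N (k + l) := by
  simp only [carre, leftDeriv_powerTrace]
  simp only [powerTrace_eq_sum, pow_add,
    Matrix.mul_apply, Finset.smul_sum, MvPolynomial.smul_eq_C_mul, map_mul]
  rw [Finset.sum_comm]
  exact Finset.sum_congr rfl fun i _ => Finset.sum_congr rfl fun j _ => by ring

theorem casimir_powerTrace {N : ℕ} (k : ℕ) :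
    casimir N (powerTrace N k) =
      (k : ℂ) • (∑ r ∈ Finset.range k, powerTrace N r * powerTrace N (k - r) +
        ((N : ℂ) - 1) • powerTrace N k) := by
  rw [casimir_apply, smul_add]
  congr 1
  · simp only [leftDeriv_powerTrace, Derivation.map_smul, leftDeriv_genMat_pow]
    simp only [powerTrace_eq_sum, Finset.sum_mul_sum, ← Finset.smul_sum]
    congr 1
    rw [Finset.sum_comm]
    simp only [Finset.sum_comm (s := Finset.univ) (t := Finset.range k)]
    exact Finset.sum_congr rfl fun _ _ => Finset.sum_comm
  · simp only [leftDeriv_powerTrace, ← Finset.smul_sum]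
    rw [smul_comm, powerTrace_eq_sum]

/-- The algebra generated by the power sums. -/
def traceAlg (N : ℕ) : Subalgebra ℂ (MatPoly N) := Algebra.adjoin ℂ (Set.range (powerTrace N))

theorem powerTrace_mem (N k : ℕ) : powerTrace N k ∈ traceAlg N :=
  Algebra.subset_adjoin ⟨k, rfl⟩

theorem carre_mem_traceAlg {N : ℕ} {f g : MatPoly N} (hf : f ∈ traceAlg N) (hg : g ∈ traceAlg N) :
    carre f g ∈ traceAlg N := by
  have key : ∀ h : MatPoly N, (∀ k, carre (powerTrace N k) h ∈ traceAlg N) →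
      ∀ f ∈ traceAlg N, carre f h ∈ traceAlg N := by
    intro h hh f hf
    induction hf using Algebra.adjoin_induction with
    | mem x hx => obtain ⟨k, rfl⟩ := hx; exact hh k
    | algebraMap r => simp [carre]
    | add x y _ _ hx hy =>
      have : carre (x + y) h = carre x h + carre y h := by
        simp [carre, add_mul, Finset.sum_add_distrib]
      rw [this]; exact add_mem hx hy
    | mul x y hx' hy' hx hy =>
      rw [carre_mul]
      exact add_mem (mul_mem hx' hy) (mul_mem hy' hx)
  refine key g (fun k => ?_) f hf
  rw [carre_comm]
  refine key _ (fun l => ?_) g hg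
  rw [carre_powerTrace]
  exact Subalgebra.smul_mem _ (powerTrace_mem _ _) _

theorem casimir_mem_traceAlg {N : ℕ} {f : MatPoly N} (hf : f ∈ traceAlg N) :
    casimir N f ∈ traceAlg N := by
  induction hf using Algebra.adjoin_induction with
  | mem x hx =>
    obtain ⟨k, rfl⟩ := hx
    rw [casimir_powerTrace]
    exact Subalgebra.smul_mem _ (add_mem (sum_mem fun r _ =>
      mul_mem (powerTrace_mem _ _) (powerTrace_mem _ _))
      (Subalgebra.smul_mem _ (powerTrace_mem _ _) _)) _
  | algebraMap r => simp [casimir_apply]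
  | add x y _ _ hx hy => rw [map_add]; exact add_mem hx hy
  | mul x y hx' hy' hx hy =>
    rw [casimir_mul]
    exact add_mem (add_mem (mul_mem hx' hy) (mul_mem hy' hx))
      (mul_mem (ofNat_mem _ 2) (carre_mem_traceAlg hx' hy'))

/-- Restriction of a polynomial function to diagonal matrices. -/
def diagRes (N : ℕ) : MatPoly N →ₐ[ℂ] MvPolynomial (Fin N) ℂ :=
  MvPolynomial.aeval (fun p => if p.1 = p.2 then MvPolynomial.X p.1 else 0)

theorem diagRes_genMat_pow {N : ℕ} (k : ℕ) (a b : Fin N) :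
    diagRes N ((genMat N ^ k) a b) = if a = b then MvPolynomial.X a ^ k else 0 := by
  have h1 : (genMat N).map (diagRes N) = Matrix.diagonal MvPolynomial.X := by
    ext1 a b
    simp [genMat_apply, diagRes, Matrix.diagonal_apply]
  have h2 : (genMat N ^ k).map (diagRes N) = Matrix.diagonal (MvPolynomial.X ^ k) := by
    rw [← Matrix.diagonal_pow, ← h1]
    exact map_pow (diagRes N).mapMatrix (genMat N) k
  have := congrFun (congrFun h2 a) b
  simpa [Matrix.diagonal_apply] using this

theorem diagRes_powerTrace (N k : ℕ) :
    diagRes N (powerTrace N k) = ∑ i, MvPolynomial.X i ^ k := by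
  simp [powerTrace, Matrix.trace, diagRes_genMat_pow]

theorem diagRes_leftDeriv {N : ℕ} {f : MatPoly N} (hf : f ∈ traceAlg N) (i j : Fin N) :
    diagRes N (leftDeriv i j f) = if i = j then eulerOp i (diagRes N f) else 0 := by
  induction hf using Algebra.adjoin_induction with
  | mem x hx =>
    obtain ⟨k, rfl⟩ := hx
    rw [leftDeriv_powerTrace, map_smul, diagRes_genMat_pow, diagRes_powerTrace, map_sum]
    simp only [eulerOp_X_pow, Finset.sum_ite_eq, Finset.mem_univ, if_true]
    by_cases h : i = j
    · simp [h]
    · simp [h, Ne.symm h]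
  | algebraMap r => simp
  | add x y _ _ hx hy => simp only [map_add, hx, hy]; split_ifs <;> simp
  | mul x y _ _ hx hy =>
    simp only [map_mul, Derivation.leibniz, map_add, hx, hy, smul_eq_mul]
    split_ifs <;> simp

theorem diagRes_carre {N : ℕ} {f g : MatPoly N} (hf : f ∈ traceAlg N) (hg : g ∈ traceAlg N) :
    diagRes N (carre f g) = ∑ i, eulerOp i (diagRes N f) * eulerOp i (diagRes N g) := by
  simp [carre, diagRes_leftDeriv hf, diagRes_leftDeriv hg]

/-- The radial part of the Casimir operator. -/
theorem altPoly_stair_mul_diagRes_casimir {N : ℕ} {f : MatPoly N} (hf : f ∈ traceAlg N) :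
    altPoly (stair N) * diagRes N (casimir N f) =
      altPoly (stair N) * ∑ i, eulerOp i (eulerOp i (diagRes N f)) +
        2 * ∑ i, eulerOp i (altPoly (stair N)) * eulerOp i (diagRes N f) := by
  induction hf using Algebra.adjoin_induction with
  | mem x hx =>
    obtain ⟨k, rfl⟩ := hx
    have h1 : ∀ i : Fin N, eulerOp i (∑ j, MvPolynomial.X j ^ k) =
        (k : ℂ) • (MvPolynomial.X i ^ k : MvPolynomial (Fin N) ℂ) := by
      intro i
      rw [map_sum]
      simp only [eulerOp_X_pow, Finset.sum_ite_eq, Finset.mem_univ, if_true]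
    have h2 := sum_eulerOp_altPoly_stair (N := N) k
    rw [casimir_powerTrace, diagRes_powerTrace]
    simp only [map_smul, map_add, map_sum, map_mul, diagRes_powerTrace]
    simp only [← map_sum]
    simp only [h1, Derivation.map_smul, eulerOp_X_pow, if_true, mul_smul_comm, ← Finset.smul_sum,
      h2]
    rw [← smul_add]
    congr 1
    rw [Finset.sum_range_succ]
    simp only [MvPolynomial.smul_eq_C_mul, map_sub, map_natCast, map_one, Nat.sub_self, pow_zero,
      Finset.sum_const, Finset.card_univ, Fintype.card_fin, nsmul_eq_mul, mul_one]
    ring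
  | algebraMap r => simp [casimir_apply]
  | add x y _ _ hx hy =>
    simp only [map_add, mul_add, hx, hy, Finset.sum_add_distrib]
    ring
  | mul x y hx' hy' hx hy =>
    rw [casimir_mul]
    simp only [map_add, map_mul, diagRes_carre hx' hy', Derivation.leibniz, smul_eq_mul, mul_add,
      Finset.sum_add_distrib, map_ofNat]
    rw [show ∀ a b c : MvPolynomial (Fin N) ℂ, a * (b * c) = b * (a * c) from
      fun a b c => by ring, hy, show ∀ a b c : MvPolynomial (Fin N) ℂ, a * (b * c) = b * (a * c)
      from fun a b c => by ring, hx]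
    simp only [mul_add, Finset.mul_sum, ← Finset.sum_add_distrib]
    exact Finset.sum_congr rfl fun i _ => by ring

theorem altPoly_stair_mul_diagRes_casimir' {N : ℕ} {f : MatPoly N} (hf : f ∈ traceAlg N) :
    altPoly (stair N) * diagRes N (casimir N f) =
      ∑ i, eulerOp i (eulerOp i (altPoly (stair N) * diagRes N f)) -
        (∑ i, (stair N i : ℂ) ^ 2) • (altPoly (stair N) * diagRes N f) := by
  rw [altPoly_stair_mul_diagRes_casimir hf, ← smul_mul_assoc, ← sum_eulerOp_eulerOp_altPoly]
  simp only [Derivation.leibniz, map_add, smul_eq_mul, Finset.sum_add_distrib, Finset.mul_sum,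
    Finset.sum_mul]
  simp only [← Finset.sum_add_distrib, ← Finset.sum_sub_distrib]
  exact Finset.sum_congr rfl fun i _ => by ring

/-- Complete homogeneous functions as polynomials in the matrix entries. -/
def hPoly (N : ℕ) : ℕ → MatPoly N
  | 0 => 1
  | (k+1) => ((k : ℂ) + 1)⁻¹ • ∑ m ∈ Finset.range (k+1), powerTrace N (m+1) * hPoly N (k - m)
  termination_by k => k
  decreasing_by exact Nat.lt_succ_of_le (Nat.sub_le _ _)

theorem hPoly_zero (N : ℕ) : hPoly N 0 = 1 := by rw [hPoly]

theorem hPoly_succ (N k : ℕ) : ((k : MatPoly N) + 1) * hPoly N (k + 1) =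
    ∑ m ∈ Finset.range (k+1), powerTrace N (m+1) * hPoly N (k - m) := by
  rw [hPoly, show ((k : MatPoly N) + 1) = MvPolynomial.C ((k : ℂ) + 1) by simp,
    ← MvPolynomial.smul_eq_C_mul, smul_smul,
    mul_inv_cancel₀ (by exact_mod_cast Nat.succ_ne_zero k), one_smul]

/-- Evaluation of a polynomial function at a matrix. -/
def evalMat {N : ℕ} (X : Matrix (Fin N) (Fin N) ℂ) : MatPoly N →ₐ[ℂ] ℂ :=
  MvPolynomial.aeval (fun p => X p.1 p.2)

theorem evalMat_X {N : ℕ} (X : Matrix (Fin N) (Fin N) ℂ) (p : Fin N × Fin N) :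
    evalMat X (MvPolynomial.X p) = X p.1 p.2 := by simp [evalMat]

theorem map_genMat {N : ℕ} (X : Matrix (Fin N) (Fin N) ℂ) :
    (genMat N).map (evalMat X) = X := by
  ext a b
  simp [genMat_apply, evalMat_X]

theorem evalMat_powerTrace {N : ℕ} (X : Matrix (Fin N) (Fin N) ℂ) (k : ℕ) :
    evalMat X (powerTrace N k) = (X ^ k).trace := by
  have h : (genMat N ^ k).map (evalMat X) = X ^ k := by
    conv_rhs => rw [← map_genMat X]
    exact map_pow (evalMat X).mapMatrix (genMat N) k
  rw [powerTrace, ← h]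
  simp [Matrix.trace]

theorem evalMat_hPoly {N : ℕ} (X : Matrix (Fin N) (Fin N) ℂ) (k : ℕ) :
    evalMat X (hPoly N k) = hMat X k := by
  induction k using Nat.strong_induction_on with
  | _ k ih =>
    cases k with
    | zero => rw [hPoly, hMat, map_one]
    | succ k =>
      rw [hPoly, hMat, map_smul, map_sum, smul_eq_mul]
      congr 1
      refine Finset.sum_congr rfl fun m _ => ?_
      rw [map_mul, evalMat_powerTrace, ih _ (by omega)]

theorem hPoly_mem (N k : ℕ) : hPoly N k ∈ traceAlg N := by
  induction k using Nat.strong_induction_on with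
  | _ k ih =>
    cases k with
    | zero => rw [hPoly]; exact one_mem _
    | succ k =>
      rw [hPoly]
      exact Subalgebra.smul_mem _ (sum_mem fun m _ =>
        mul_mem (powerTrace_mem _ _) (ih _ (by omega))) _

/-- The Schur polynomials with shifted exponents `α = λ + ρ`, as functions of a matrix. -/
def schurPoly {N : ℕ} (α : Fin N → ℕ) : MatPoly N := jacobiTrudi (hPoly N) α

theorem schur_eq_evalMat {N : ℕ} (l : Fin N → ℕ) (X : Matrix (Fin N) (Fin N) ℂ) :
    schur l X = evalMat X (schurPoly (fun i => l i + stair N i)) := by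
  rw [schur_eq_jacobiTrudi, schurPoly]
  have := map_jacobiTrudi (evalMat X : MatPoly N →+* ℂ) (hPoly N) (fun i => l i + stair N i)
  simp only [RingHom.coe_coe, evalMat_hPoly] at this
  exact this.symm

theorem schurPoly_mem {N : ℕ} (α : Fin N → ℕ) : schurPoly α ∈ traceAlg N := by
  unfold schurPoly jacobiTrudi
  rw [Matrix.det_apply]
  refine sum_mem fun σ _ => ?_
  rw [Units.smul_def, zsmul_eq_mul]
  refine mul_mem (intCast_mem _ _) (prod_mem fun i _ => ?_)
  simp only [Matrix.of_apply, extendZero]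
  split_ifs
  · exact zero_mem _
  · exact hPoly_mem _ _

theorem altPoly_stair_mul_diagRes_schurPoly {N : ℕ} (α : Fin N → ℕ) :
    altPoly (stair N) * diagRes N (schurPoly α) = altPoly α := by
  have h := map_jacobiTrudi (diagRes N : MatPoly N →+* MvPolynomial (Fin N) ℂ) (hPoly N) α
  rw [mul_comm, schurPoly]
  simp only [RingHom.coe_coe] at h
  rw [h]
  refine jacobiTrudi_mul_alternant MvPolynomial.X _ ?_ ?_ α
  · simp [hPoly_zero]
  · intro k
    have := congrArg (diagRes N) (hPoly_succ N k)
    simpa [diagRes_powerTrace] using this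

theorem diagRes_eq_of_altPoly {N : ℕ} {f g : MvPolynomial (Fin N) ℂ}
    (h : altPoly (stair N) * f = altPoly (stair N) * g) : f = g :=
  mul_left_cancel₀ (altPoly_stair_ne_zero N) h

theorem diagRes_casimir_schurPoly {N : ℕ} (α : Fin N → ℕ) :
    diagRes N (casimir N (schurPoly α)) =
      diagRes N ((∑ i, (α i : ℂ) ^ 2 - ∑ i, (stair N i : ℂ) ^ 2) • schurPoly α) := by
  apply diagRes_eq_of_altPoly
  rw [altPoly_stair_mul_diagRes_casimir' (schurPoly_mem α), map_smul, mul_smul_comm,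
    altPoly_stair_mul_diagRes_schurPoly, sum_eulerOp_eulerOp_altPoly, sub_smul]

theorem hasDerivAt_evalMat {N : ℕ} {γ : ℝ → Matrix (Fin N) (Fin N) ℂ}
    {Y : Matrix (Fin N) (Fin N) ℂ} (hγ : ∀ a b, HasDerivAt (fun t => γ t a b) (Y a b) 0)
    (f : MatPoly N) :
    HasDerivAt (fun t => evalMat (γ t) f)
      (∑ p : Fin N × Fin N, Y p.1 p.2 * evalMat (γ 0) (MvPolynomial.pderiv p f)) 0 := by
  induction f using MvPolynomial.induction_on with
  | C a => simpa [evalMat] using hasDerivAt_const (0 : ℝ) a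
  | add p q hp hq => simpa [mul_add, Finset.sum_add_distrib] using hp.fun_add hq
  | mul_X p i hp =>
    have := hp.fun_mul (hγ i.1 i.2)
    simp only [map_mul, evalMat_X]
    refine this.congr_deriv ?_
    simp only [Derivation.leibniz, MvPolynomial.pderiv_X, smul_eq_mul, map_add, map_mul,
      evalMat_X, mul_add, Finset.sum_add_distrib, Finset.sum_mul]
    rw [add_comm]
    congr 1
    · rw [Finset.sum_eq_single i]
      · simp [mul_comm]
      · intro j _ hj; simp [hj.symm]
      · simp
    · exact Finset.sum_congr rfl fun _ _ => by ring

theorem eq_zero_of_pderiv_closed {N : ℕ} {Z : Set (Matrix (Fin N) (Fin N) ℂ)} (hne : Z.Nonempty)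
    (hZ : ∀ f : MatPoly N, (∀ X ∈ Z, evalMat X f = 0) →
      ∀ p, ∀ X ∈ Z, evalMat X (MvPolynomial.pderiv p f) = 0)
    {f : MatPoly N} (hf : ∀ X ∈ Z, evalMat X f = 0) : f = 0 := by
  have key : ∀ n : ℕ, ∀ f : MatPoly N, (∀ X ∈ Z, evalMat X f = 0) →
      (∀ d, f.coeff d ≠ 0 → d.degree < n) → f = 0 := by
    intro n
    induction n with
    | zero =>
      intro f _ hd
      ext d
      by_contra h
      exact absurd (hd d (by simpa using h)) (by omega)
    | succ n ih =>
      intro f hf hd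
      have hp : ∀ p, MvPolynomial.pderiv p f = 0 := by
        intro p
        refine ih _ (hZ f hf p) fun d h => ?_
        rw [MvPolynomial.coeff_pderiv] at h
        have := hd (d + Finsupp.single p 1) (fun h0 => h (by simp [h0]))
        simp only [map_add, Finsupp.degree_single] at this
        omega
      have hC : f = MvPolynomial.C (f.coeff 0) := by
        ext d
        rw [MvPolynomial.coeff_C]
        split_ifs with h0
        · rw [h0]
        · obtain ⟨p, hpd⟩ : ∃ p, d p ≠ 0 := by
            by_contra! h
            exact h0 (Finsupp.ext fun p => (h p).symm)
          have h1 : d = (d - Finsupp.single p 1) + Finsupp.single p 1 :=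
            (tsub_add_cancel_of_le (Finsupp.single_le_iff.2 (Nat.one_le_iff_ne_zero.2 hpd))).symm
          have h2 := MvPolynomial.coeff_pderiv (i := p) f (d - Finsupp.single p 1)
          rw [hp p, ← h1, MvPolynomial.coeff_zero] at h2
          exact (mul_eq_zero.1 h2.symm).resolve_right (Nat.cast_add_one_ne_zero _)
      obtain ⟨X, hX⟩ := hne
      have := hf X hX
      rw [hC] at this ⊢
      simpa [evalMat] using this
  exact key (f.totalDegree + 1) f hf fun d hd => Nat.lt_succ_of_le
    (MvPolynomial.le_totalDegree (MvPolynomial.mem_support_iff.2 hd))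

theorem eq_zero_of_isHermitian {N : ℕ} {φ : Matrix (Fin N) (Fin N) ℂ →ₗ[ℂ] ℂ}
    (h : ∀ H : Matrix (Fin N) (Fin N) ℂ, H.IsHermitian → φ H = 0) : φ = 0 := by
  ext1 Y
  have h1 := realPart_add_I_smul_imaginaryPart Y
  rw [← h1, map_add, map_smul, h _ (realPart Y).2, h _ (imaginaryPart Y).2]
  simp

/-- The differential of a polynomial function. -/
def differential {N : ℕ} (X : Matrix (Fin N) (Fin N) ℂ) (f : MatPoly N) :
    Matrix (Fin N) (Fin N) ℂ →ₗ[ℂ] ℂ where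
  toFun Y := ∑ p : Fin N × Fin N, Y p.1 p.2 * evalMat X (MvPolynomial.pderiv p f)
  map_add' Y Z := by simp [add_mul, Finset.sum_add_distrib]
  map_smul' c Y := by simp [Finset.mul_sum, mul_assoc]

theorem differential_single {N : ℕ} (X : Matrix (Fin N) (Fin N) ℂ) (f : MatPoly N)
    (p : Fin N × Fin N) :
    differential X f (Matrix.single p.1 p.2 1) = evalMat X (MvPolynomial.pderiv p f) := by
  change ∑ q : Fin N × Fin N, _ = _
  rw [Finset.sum_eq_single p]
  · simp
  · intro q _ hq
    have : ¬ (p.1 = q.1 ∧ p.2 = q.2) := fun h => hq (Prod.ext h.1 h.2).symm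
    simp [this]
  · simp

/-- Hermitian matrices are Zariski dense. -/
theorem matPoly_eq_zero_of_hermitian {N : ℕ} {f : MatPoly N}
    (hf : ∀ X : Matrix (Fin N) (Fin N) ℂ, X.IsHermitian → evalMat X f = 0) : f = 0 := by
  refine eq_zero_of_pderiv_closed (Z := {X | X.IsHermitian}) ⟨0, Matrix.isHermitian_zero⟩ ?_ hf
  intro f hf p X hX
  have : differential X f = 0 := by
    refine eq_zero_of_isHermitian fun H hH => ?_
    have h1 : ∀ a b, HasDerivAt (fun t : ℝ => (X + (t : ℂ) • H) a b) (H a b) 0 := by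
      intro a b
      have := ((Complex.ofRealCLM.hasDerivAt (x := 0)).mul_const (H a b)).const_add (X a b)
      simpa using this
    have h2 := hasDerivAt_evalMat h1 f
    have h3 : (fun t : ℝ => evalMat (X + (t : ℂ) • H) f) = fun _ => 0 := by
      funext t
      refine hf _ (Matrix.IsHermitian.add hX ?_)
      unfold Matrix.IsHermitian at *
      rw [Matrix.conjTranspose_smul, hH]
      simp
    rw [h3] at h2
    have := h2.unique (hasDerivAt_const _ _)
    simpa [differential] using this
  rw [← differential_single, this, LinearMap.zero_apply]

section
attribute [local instance] Matrix.linftyOpNormedRing Matrix.linftyOpNormedAlgebra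

theorem exists_unitary_curve {N : ℕ} (U : UN N) {H : Matrix (Fin N) (Fin N) ℂ}
    (hH : H.IsHermitian) : ∃ γ : ℝ → UN N, γ 0 = U ∧
      ∀ a b, HasDerivAt (fun t => (γ t : Matrix (Fin N) (Fin N) ℂ) a b)
        ((Complex.I • H * (U : Matrix (Fin N) (Fin N) ℂ)) a b) 0 := by
  have hs : ∀ t : ℝ, NormedSpace.exp (t • (Complex.I • H)) ∈ UN N := by
    intro t
    have h1 : (t • (Complex.I • H))ᴴ = -(t • (Complex.I • H)) := by
      rw [Matrix.conjTranspose_smul, Matrix.conjTranspose_smul, hH]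
      simp
    rw [Matrix.mem_unitaryGroup_iff, Matrix.star_eq_conjTranspose, ← Matrix.exp_conjTranspose, h1,
      ← Matrix.exp_add_of_commute _ _ (Commute.refl (t • (Complex.I • H))).neg_right,
      add_neg_cancel,
      NormedSpace.exp_zero]
  refine ⟨fun t => ⟨NormedSpace.exp (t • (Complex.I • H)), hs t⟩ * U, ?_, ?_⟩
  · ext1
    simp
  · intro a b
    have h := (hasDerivAt_exp_smul_const (𝕂 := ℝ) (Complex.I • H) (0 : ℝ)).mul_const
      (U : Matrix (Fin N) (Fin N) ℂ)
    simp only [zero_smul, NormedSpace.exp_zero, one_mul] at h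
    exact (LinearMap.toContinuousLinearMap
      (Matrix.entryLinearMap ℝ ℂ a b)).hasFDerivAt.comp_hasDerivAt _ h
end

/-- Unitary matrices are Zariski dense. -/
theorem matPoly_eq_zero_of_unitary {N : ℕ} {f : MatPoly N}
    (hf : ∀ U : UN N, evalMat (U : Matrix (Fin N) (Fin N) ℂ) f = 0) : f = 0 := by
  refine eq_zero_of_pderiv_closed (Z := Set.range (fun U : UN N => (U : Matrix (Fin N) (Fin N) ℂ)))
    ⟨_, 1, rfl⟩ ?_ (by rintro _ ⟨U, rfl⟩; exact hf U)
  rintro f hf p _ ⟨U, rfl⟩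
  have h0 : (differential (U : Matrix (Fin N) (Fin N) ℂ) f).comp
      (LinearMap.mulRight ℂ (U : Matrix (Fin N) (Fin N) ℂ)) = 0 := by
    refine eq_zero_of_isHermitian fun H hH => ?_
    obtain ⟨γ, hγ0, hγ⟩ := exists_unitary_curve U hH
    have h2 := hasDerivAt_evalMat hγ f
    have h3 : (fun t : ℝ => evalMat (γ t : Matrix (Fin N) (Fin N) ℂ) f) = fun _ => 0 :=
      funext fun t => hf _ ⟨γ t, rfl⟩
    rw [h3, hγ0] at h2
    have h4 := h2.unique (hasDerivAt_const _ _)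
    change differential (U : Matrix (Fin N) (Fin N) ℂ) f
      (Complex.I • H * (U : Matrix (Fin N) (Fin N) ℂ)) = 0 at h4
    rw [Matrix.smul_mul, map_smul, smul_eq_mul] at h4
    simpa using h4
  have h1 := LinearMap.congr_fun h0 (Matrix.single p.1 p.2 1 * star (U : Matrix (Fin N) (Fin N) ℂ))
  rw [← differential_single]
  simpa [mul_assoc] using h1

/-- Polynomial functions invariant under unitary conjugation. -/
def IsClass {N : ℕ} (f : MatPoly N) : Prop :=
  ∀ (U : UN N) (X : Matrix (Fin N) (Fin N) ℂ),
    evalMat (star (U : Matrix (Fin N) (Fin N) ℂ) * X * (U : Matrix (Fin N) (Fin N) ℂ)) f =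
      evalMat X f

theorem star_mul_mul_pow {N : ℕ} (U : UN N) (X : Matrix (Fin N) (Fin N) ℂ) (k : ℕ) :
    (star (U : Matrix (Fin N) (Fin N) ℂ) * X * (U : Matrix (Fin N) (Fin N) ℂ)) ^ k =
      star (U : Matrix (Fin N) (Fin N) ℂ) * X ^ k * (U : Matrix (Fin N) (Fin N) ℂ) := by
  induction k with
  | zero => simp
  | succ k ih =>
    rw [pow_succ, ih, pow_succ]
    have := Unitary.mul_star_self_of_mem U.2
    calc _ = star (U : Matrix (Fin N) (Fin N) ℂ) * X ^ k *
          ((U : Matrix (Fin N) (Fin N) ℂ) * star (U : Matrix (Fin N) (Fin N) ℂ)) * X *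
          (U : Matrix (Fin N) (Fin N) ℂ) := by simp only [mul_assoc]
      _ = _ := by rw [this]; simp only [mul_assoc, mul_one]

theorem isClass_of_mem_traceAlg {N : ℕ} {f : MatPoly N} (hf : f ∈ traceAlg N) : IsClass f := by
  intro U X
  induction hf using Algebra.adjoin_induction with
  | mem x hx =>
    obtain ⟨k, rfl⟩ := hx
    rw [evalMat_powerTrace, evalMat_powerTrace, star_mul_mul_pow, Matrix.trace_mul_comm,
      ← mul_assoc, Unitary.mul_star_self_of_mem U.2, one_mul]
  | algebraMap r => simp
  | add x y _ _ hx hy => simp [hx, hy]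
  | mul x y _ _ hx hy => simp [hx, hy]

theorem IsClass.add {N : ℕ} {f g : MatPoly N} (hf : IsClass f) (hg : IsClass g) :
    IsClass (f + g) := fun U X => by rw [map_add, map_add, hf U X, hg U X]

theorem IsClass.mul {N : ℕ} {f g : MatPoly N} (hf : IsClass f) (hg : IsClass g) :
    IsClass (f * g) := fun U X => by rw [map_mul, map_mul, hf U X, hg U X]

theorem IsClass.smul {N : ℕ} {f : MatPoly N} (hf : IsClass f) (c : ℂ) :
    IsClass (c • f) := fun U X => by rw [map_smul, map_smul, hf U X]

theorem IsClass.sub {N : ℕ} {f g : MatPoly N} (hf : IsClass f) (hg : IsClass g) :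
    IsClass (f - g) := fun U X => by rw [map_sub, map_sub, hf U X, hg U X]

theorem isClass_schurPoly {N : ℕ} (α : Fin N → ℕ) : IsClass (schurPoly α) :=
  isClass_of_mem_traceAlg (schurPoly_mem α)

theorem evalMat_diagonal {N : ℕ} (x : Fin N → ℂ) (f : MatPoly N) :
    evalMat (Matrix.diagonal x) f = MvPolynomial.aeval x (diagRes N f) := by
  have : evalMat (Matrix.diagonal x) = (MvPolynomial.aeval x).comp (diagRes N) := by
    refine MvPolynomial.algHom_ext fun p => ?_
    simp only [evalMat_X, diagRes, AlgHom.comp_apply, MvPolynomial.aeval_X, Matrix.diagonal_apply]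
    split_ifs <;> simp
  rw [this, AlgHom.comp_apply]

/-- A class polynomial is determined by its restriction to diagonal matrices. -/
theorem IsClass.eq_of_diagRes {N : ℕ} {f g : MatPoly N} (hf : IsClass f) (hg : IsClass g)
    (h : diagRes N f = diagRes N g) : f = g := by
  rw [← sub_eq_zero]
  refine matPoly_eq_zero_of_hermitian fun X hX => ?_
  have h1 := hX.spectral_theorem
  rw [Unitary.conjStarAlgAut_apply] at h1
  have h2 := (hf.sub hg) (star hX.eigenvectorUnitary)
    (Matrix.diagonal ((RCLike.ofReal : ℝ → ℂ) ∘ hX.eigenvalues))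
  rw [Unitary.coe_star, star_star, ← h1] at h2
  rw [h2, evalMat_diagonal, map_sub, h, sub_self, map_zero]

theorem IsClass.isSymmetric {N : ℕ} {f : MatPoly N} (hf : IsClass f) :
    (diagRes N f).IsSymmetric := by
  intro σ
  refine MvPolynomial.funext fun x => ?_
  have hP : (σ.permMatrix ℂ) ∈ Matrix.unitaryGroup (Fin N) ℂ := by
    rw [Matrix.mem_unitaryGroup_iff, Matrix.star_eq_conjTranspose,
      Matrix.conjTranspose_permMatrix, ← Matrix.permMatrix_mul]
    simp
  have h := hf ⟨_, hP⟩ (Matrix.diagonal (x ∘ σ))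
  have h2 : star (σ.permMatrix ℂ) * Matrix.diagonal (x ∘ σ) * σ.permMatrix ℂ =
      Matrix.diagonal x := by
    rw [Matrix.star_eq_conjTranspose, Matrix.conjTranspose_permMatrix, Equiv.Perm.permMatrix,
      Equiv.Perm.permMatrix, PEquiv.toMatrix_toPEquiv_mul, PEquiv.mul_toMatrix_toPEquiv]
    ext a b
    simp [Matrix.diagonal_apply, Equiv.Perm.inv_def]
  simp only [h2] at h
  rw [evalMat_diagonal, evalMat_diagonal] at h
  rw [MvPolynomial.eval_rename]
  simpa [MvPolynomial.aeval_eq_eval] using h.symm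

theorem IsClass.eq_sum_schurPoly {N : ℕ} {f : MatPoly N} (hf : IsClass f) :
    f = ∑ β ∈ (diagRes N f).support,
      (diagRes N f).coeff β • schurPoly (stair N + ⇑β) := by
  have hs : ∀ s : Finset (Fin N →₀ ℕ), ∀ c : (Fin N →₀ ℕ) → ℂ,
      IsClass (∑ β ∈ s, c β • schurPoly (stair N + ⇑β)) := fun s c =>
    isClass_of_mem_traceAlg (sum_mem fun β _ => Subalgebra.smul_mem _ (schurPoly_mem _) _)
  refine hf.eq_of_diagRes (hs _ _) (diagRes_eq_of_altPoly ?_)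
  rw [mul_comm, symmetric_mul_altPoly hf.isSymmetric, map_sum, Finset.mul_sum]
  refine Finset.sum_congr rfl fun β _ => ?_
  rw [map_smul, mul_smul_comm, altPoly_stair_mul_diagRes_schurPoly, MvPolynomial.smul_eq_C_mul]

theorem casimir_schurPoly {N : ℕ} (α : Fin N → ℕ) :
    casimir N (schurPoly α) =
      (∑ i, (α i : ℂ) ^ 2 - ∑ i, (stair N i : ℂ) ^ 2) • schurPoly α :=
  (isClass_of_mem_traceAlg (casimir_mem_traceAlg (schurPoly_mem α))).eq_of_diagRes
    ((isClass_schurPoly α).smul _) (diagRes_casimir_schurPoly α)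

/-- A class polynomial is determined by the product of its diagonal restriction with the
Vandermonde alternant. -/
theorem IsClass.eq_of_altPoly {N : ℕ} {f g : MatPoly N} (hf : IsClass f) (hg : IsClass g)
    (h : altPoly (stair N) * diagRes N f = altPoly (stair N) * diagRes N g) : f = g :=
  hf.eq_of_diagRes hg (diagRes_eq_of_altPoly h)

theorem schurPoly_eq_zero {N : ℕ} {α : Fin N → ℕ} (h : ¬ Function.Injective α) :
    schurPoly α = 0 := by
  refine (isClass_schurPoly α).eq_of_altPoly (isClass_of_mem_traceAlg (zero_mem _)) ?_
  rw [altPoly_stair_mul_diagRes_schurPoly, altPoly_eq_zero h, map_zero, mul_zero]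

theorem schurPoly_comp_perm {N : ℕ} (α : Fin N → ℕ) (σ : Equiv.Perm (Fin N)) :
    schurPoly (α ∘ σ) = ((Equiv.Perm.sign σ : ℤ) : ℂ) • schurPoly α := by
  refine (isClass_schurPoly _).eq_of_altPoly ((isClass_schurPoly α).smul _) ?_
  rw [map_smul, mul_smul_comm, altPoly_stair_mul_diagRes_schurPoly,
    altPoly_stair_mul_diagRes_schurPoly, altPoly_comp_perm, MvPolynomial.smul_eq_C_mul]

/-- The determinant as a polynomial. -/
def detPoly (N : ℕ) : MatPoly N := (genMat N).det

theorem evalMat_detPoly {N : ℕ} (X : Matrix (Fin N) (Fin N) ℂ) :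
    evalMat X (detPoly N) = X.det := by
  conv_rhs => rw [← map_genMat X]
  exact AlgHom.map_det (evalMat X) (genMat N)

theorem isClass_detPoly (N : ℕ) : IsClass (detPoly N) := by
  intro U X
  rw [evalMat_detPoly, evalMat_detPoly, Matrix.det_mul, Matrix.det_mul, mul_right_comm,
    ← Matrix.det_mul, Unitary.star_mul_self_of_mem U.2, Matrix.det_one, one_mul]

theorem diagRes_detPoly (N : ℕ) : diagRes N (detPoly N) = ∏ i, MvPolynomial.X i := by
  rw [detPoly, AlgHom.map_det, ← Matrix.det_diagonal]
  congr 1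
  ext1 a b
  simp [genMat_apply, diagRes, Matrix.diagonal_apply]

theorem prod_X_pow_mul_altPoly {N : ℕ} (α : Fin N → ℕ) (q : ℕ) :
    (∏ i, MvPolynomial.X i) ^ q * altPoly α = altPoly (fun i => α i + q) := by
  have := Matrix.det_mul_row (fun j : Fin N => (MvPolynomial.X j : MvPolynomial (Fin N) ℂ) ^ q)
    (Matrix.of fun i j : Fin N => (MvPolynomial.X j : MvPolynomial (Fin N) ℂ) ^ α i)
  unfold altPoly alternant
  rw [← Finset.prod_pow, ← this]
  congr 1
  ext1 i j
  simp [pow_add, mul_comm]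

theorem IsClass.pow {N : ℕ} {f : MatPoly N} (hf : IsClass f) (q : ℕ) : IsClass (f ^ q) :=
  fun U X => by rw [map_pow, map_pow, hf U X]

theorem schurPoly_add_const {N : ℕ} (α : Fin N → ℕ) (q : ℕ) :
    schurPoly (fun i => α i + q) = detPoly N ^ q * schurPoly α := by
  refine (isClass_schurPoly _).eq_of_altPoly (((isClass_detPoly N).pow q).mul
    (isClass_schurPoly α)) ?_
  rw [altPoly_stair_mul_diagRes_schurPoly, map_mul, mul_left_comm,
    altPoly_stair_mul_diagRes_schurPoly, map_pow, diagRes_detPoly, prod_X_pow_mul_altPoly]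

theorem schurPoly_stair (N : ℕ) : schurPoly (stair N) = 1 :=
  jacobiTrudi_stair _ (hPoly_zero N)

/-- The sum of the first `k` entries of `x`. -/
def initialSum {R : Type*} [AddCommMonoid R] {N : ℕ} (x : Fin N → R) (k : ℕ) : R :=
  ∑ i with i.val < k, x i

theorem initialSum_succ {R : Type*} [AddCommMonoid R] {N : ℕ} (x : Fin N → R) (i : Fin N) :
    initialSum x (i + 1) = initialSum x i + x i := by
  have h : (Finset.univ.filter fun j : Fin N => j.val < i + 1) =
      insert i (Finset.univ.filter fun j : Fin N => j.val < i) := by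
    ext j
    simp only [Finset.mem_filter, Finset.mem_univ, true_and, Finset.mem_insert, Fin.ext_iff]
    omega
  rw [initialSum, h, Finset.sum_insert (by simp), add_comm, initialSum]

theorem initialSum_zero {R : Type*} [AddCommMonoid R] {N : ℕ} (x : Fin N → R) :
    initialSum x 0 = 0 := by simp [initialSum]

theorem initialSum_card {R : Type*} [AddCommMonoid R] {N : ℕ} (x : Fin N → R) :
    initialSum x N = ∑ i, x i := by simp [initialSum]

theorem initialSum_add {R : Type*} [AddCommMonoid R] {N : ℕ} (x y : Fin N → R) (k : ℕ) :
    initialSum (x + y) k = initialSum x k + initialSum y k := Finset.sum_add_distrib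

theorem eq_of_initialSum_eq {N : ℕ} {x y : Fin N → ℕ}
    (h : ∀ k ≤ N, initialSum x k = initialSum y k) : x = y := by
  funext i
  have h1 := h (i + 1) i.2
  rw [initialSum_succ, initialSum_succ, h i i.2.le] at h1
  omega

theorem card_filter_val_lt {N k : ℕ} (hk : k ≤ N) :
    (Finset.univ.filter fun j : Fin N => j.val < k).card = k := by
  rw [Fin.card_filter_val_lt, min_eq_right hk]

/-- Abel summation inequality. -/
theorem mul_initialSum_le {N : ℕ} {a d : Fin N → ℤ} (ha : Antitone a)
    (hd : ∀ k ≤ N, 0 ≤ initialSum d k) (k : ℕ) (hk : k < N) :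
    a ⟨k, hk⟩ * initialSum d (k + 1) ≤ initialSum (a * d) (k + 1) := by
  induction k with
  | zero =>
    have h1 := initialSum_succ d ⟨0, hk⟩
    have h2 := initialSum_succ (a * d) ⟨0, hk⟩
    simp only [initialSum_zero, zero_add, Pi.mul_apply] at h1 h2
    simp only [zero_add, h1, h2, le_refl]
  | succ k ih =>
    have h1 := initialSum_succ d ⟨k + 1, hk⟩
    have h2 := initialSum_succ (a * d) ⟨k + 1, hk⟩
    simp only [Pi.mul_apply] at h1 h2
    rw [h1, h2, mul_add]
    gcongr
    refine le_trans ?_ (ih (by omega))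
    exact mul_le_mul_of_nonneg_right (ha (Fin.mk_le_mk.2 (Nat.le_succ k))) (hd _ (by omega))

theorem exists_antitone_comp {N : ℕ} (α : Fin N → ℕ) :
    ∃ σ : Equiv.Perm (Fin N), Antitone (α ∘ σ) :=
  ⟨Tuple.sort (OrderDual.toDual ∘ α), fun _ _ h => Tuple.monotone_sort (OrderDual.toDual ∘ α) h⟩

/-- A vector majorized by `τ` with the same Euclidean norm is a permutation of `τ`. -/
theorem exists_eq_comp_perm {N : ℕ} {α τ : Fin N → ℕ}
    (h : ∀ S : Finset (Fin N), ∑ i ∈ S, α i ≤ initialSum τ S.card)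
    (hn : ∑ i, α i ^ 2 = ∑ i, τ i ^ 2) : ∃ σ : Equiv.Perm (Fin N), α = τ ∘ σ := by
  obtain ⟨σ, hσ⟩ := exists_antitone_comp α
  suffices h1 : ∀ i, τ i = α (σ i) from ⟨σ⁻¹, funext fun i => by simp [h1]⟩
  have hd : ∀ k ≤ N, 0 ≤ initialSum (fun i => (τ i : ℤ) - α (σ i)) k := by
    intro k hk
    have h1 := h ((Finset.univ.filter fun j : Fin N => j.val < k).map σ.toEmbedding)
    rw [Finset.sum_map, Finset.card_map, card_filter_val_lt hk] at h1
    unfold initialSum at h1 ⊢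
    rw [Finset.sum_sub_distrib, sub_nonneg]
    exact_mod_cast h1
  have h2 : 0 ≤ ∑ i, (α (σ i) : ℤ) * (τ i - α (σ i)) := by
    have hx := mul_initialSum_le (a := fun i => (α (σ i) : ℤ))
      (fun i j hij => Int.ofNat_le.2 (hσ hij)) hd
    rcases Nat.eq_zero_or_pos N with rfl | hN
    · simp
    · have hx' := hx (N - 1) (by omega)
      rw [Nat.sub_add_cancel hN] at hx'
      have := initialSum_card ((fun i => (α (σ i) : ℤ)) * fun i => (τ i : ℤ) - α (σ i))
      simp only [Pi.mul_apply] at this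
      rw [← this]
      exact le_trans (mul_nonneg (by positivity) (hd N le_rfl)) hx'
  have h3 : ∑ i, (α (σ i) : ℤ) ^ 2 = ∑ i, (τ i : ℤ) ^ 2 := by
    rw [Equiv.sum_comp σ (fun i => (α i : ℤ) ^ 2)]
    exact_mod_cast hn
  have h4 : ∑ i, ((τ i : ℤ) - α (σ i)) ^ 2 ≤ 0 := by
    have : ∑ i, ((τ i : ℤ) - α (σ i)) ^ 2 = ∑ i, (τ i : ℤ) ^ 2 - ∑ i, (α (σ i) : ℤ) ^ 2 -
        2 * ∑ i, (α (σ i) : ℤ) * (τ i - α (σ i)) := by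
      rw [Finset.mul_sum, ← Finset.sum_sub_distrib, ← Finset.sum_sub_distrib]
      exact Finset.sum_congr rfl fun i _ => by ring
    rw [this, h3]
    linarith
  have h5 := (Finset.sum_eq_zero_iff_of_nonneg (fun i _ => sq_nonneg _)).1
    (le_antisymm h4 (Finset.sum_nonneg fun i _ => sq_nonneg _))
  intro i
  have := pow_eq_zero_iff (two_ne_zero) |>.1 (h5 i (Finset.mem_univ i))
  omega

/-- All exponents of `f` are majorized by `τ`. -/
def Dominated {N : ℕ} (τ : Fin N → ℕ) (f : MvPolynomial (Fin N) ℂ) : Prop :=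
  ∀ β ∈ f.support, ∀ S : Finset (Fin N), ∑ i ∈ S, β i ≤ initialSum τ S.card

theorem dominated_iff {N : ℕ} {τ : Fin N → ℕ} {f : MvPolynomial (Fin N) ℂ} :
    Dominated τ f ↔ ∀ β : Fin N →₀ ℕ,
      (¬ ∀ S : Finset (Fin N), ∑ i ∈ S, β i ≤ initialSum τ S.card) → f.coeff β = 0 := by
  refine forall_congr' fun β => ?_
  rw [MvPolynomial.mem_support_iff, ne_eq, not_imp_comm]

theorem Dominated.mul {N : ℕ} {τ κ : Fin N → ℕ} {f g : MvPolynomial (Fin N) ℂ}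
    (hf : Dominated τ f) (hg : Dominated κ g) : Dominated (τ + κ) (f * g) := by
  intro β hβ S
  obtain ⟨a, ha, b, hb, rfl⟩ := Finset.mem_add.1 (MvPolynomial.support_mul f g hβ)
  rw [initialSum_add]
  simp only [Finsupp.add_apply, Finset.sum_add_distrib]
  exact add_le_add (hf a ha S) (hg b hb S)

theorem Dominated.coeff_mul {N : ℕ} {τ κ : Fin N → ℕ} {f g : MvPolynomial (Fin N) ℂ}
    (hf : Dominated τ f) (hg : Dominated κ g) :
    (f * g).coeff (Finsupp.equivFunOnFinite.symm (τ + κ)) =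
      f.coeff (Finsupp.equivFunOnFinite.symm τ) * g.coeff (Finsupp.equivFunOnFinite.symm κ) := by
  rw [MvPolynomial.coeff_mul]
  refine Finset.sum_eq_single
    (Finsupp.equivFunOnFinite.symm τ, Finsupp.equivFunOnFinite.symm κ) ?_ ?_
  · rintro ⟨a, b⟩ hab hne
    rw [Finset.HasAntidiagonal.mem_antidiagonal] at hab
    by_contra h
    obtain ⟨ha, hb⟩ := ne_zero_and_ne_zero_of_mul h
    have hab' : ⇑a + ⇑b = τ + κ := by ext i; exact DFunLike.congr_fun hab i
    have key : ∀ k ≤ N, initialSum a k = initialSum τ k ∧ initialSum b k = initialSum κ k := by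
      intro k hk
      have h1 := hf a (MvPolynomial.mem_support_iff.2 ha)
        (Finset.univ.filter fun j : Fin N => j.val < k)
      have h2 := hg b (MvPolynomial.mem_support_iff.2 hb)
        (Finset.univ.filter fun j : Fin N => j.val < k)
      have h3 := congrArg (fun x => initialSum x k) hab'
      simp only [initialSum_add] at h3
      rw [card_filter_val_lt hk] at h1 h2
      change initialSum a k ≤ _ at h1
      change initialSum b k ≤ _ at h2
      omega
    have h1 := eq_of_initialSum_eq fun k hk => (key k hk).1
    have h2 := eq_of_initialSum_eq fun k hk => (key k hk).2
    exact hne (Prod.ext (DFunLike.coe_injective h1) (DFunLike.coe_injective h2))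
  · intro h
    exact absurd (Finset.HasAntidiagonal.mem_antidiagonal.2 (by ext; simp)) h

theorem sum_le_initialSum {N : ℕ} {τ : Fin N → ℕ} (hτ : Antitone τ) (S : Finset (Fin N)) :
    ∑ i ∈ S, τ i ≤ initialSum τ S.card := by
  have hS : S.card ≤ N := by simpa using S.card_le_univ
  have h1 : initialSum τ S.card = ∑ i : Fin S.card, τ ⟨i, i.2.trans_le hS⟩ := by
    refine (Finset.sum_bij' (fun (i : Fin S.card) _ => (⟨i, i.2.trans_le hS⟩ : Fin N))
      (fun i hi => ⟨i, (Finset.mem_filter.1 hi).2⟩) ?_ ?_ ?_ ?_ ?_).symm <;> simp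
  rw [h1, ← Finset.sum_coe_sort S, ← Equiv.sum_comp (S.orderIsoOfFin rfl).toEquiv]
  refine Finset.sum_le_sum fun i _ => hτ ?_
  rw [Fin.le_def]
  have h2 : ∀ k (hk : k < S.card), k ≤ (S.orderIsoOfFin rfl ⟨k, hk⟩ : Fin N).val := by
    intro k
    induction k with
    | zero => simp
    | succ k ih =>
      intro hk
      have h3 := ih (by omega)
      have h4 : S.orderIsoOfFin rfl ⟨k, by omega⟩ < S.orderIsoOfFin rfl ⟨k + 1, hk⟩ :=
        (S.orderIsoOfFin rfl).strictMono (by simp [Fin.lt_def])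
      have h5 : (S.orderIsoOfFin rfl ⟨k, by omega⟩ : Fin N).val <
        (S.orderIsoOfFin rfl ⟨k + 1, hk⟩ : Fin N).val := h4
      omega
  exact h2 i i.2

theorem dominated_altPoly {N : ℕ} {τ : Fin N → ℕ} (hτ : Antitone τ) : Dominated τ (altPoly τ) := by
  rw [dominated_iff]
  intro β hβ
  have h := coeff_altPoly τ β
  rw [Finsupp.equivFunOnFinite_symm_coe] at h
  rw [h]
  refine Finset.sum_eq_zero fun σ _ => if_neg fun h2 => hβ fun S => ?_
  rw [h2]
  have := sum_le_initialSum hτ (S.map σ.toEmbedding)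
  simpa using this

/-- Right translation `f ↦ (X ↦ f (X * M))`. -/
def rightTrans {N : ℕ} (M : Matrix (Fin N) (Fin N) ℂ) : MatPoly N →ₐ[ℂ] MatPoly N :=
  MvPolynomial.aeval fun p => ∑ c, MvPolynomial.C (M c p.2) * MvPolynomial.X (p.1, c)

theorem rightTrans_X {N : ℕ} (M : Matrix (Fin N) (Fin N) ℂ) (p : Fin N × Fin N) :
    rightTrans M (MvPolynomial.X p) =
      ∑ c, MvPolynomial.C (M c p.2) * MvPolynomial.X (p.1, c) :=
  MvPolynomial.aeval_X _ _

theorem evalMat_rightTrans {N : ℕ} (X M : Matrix (Fin N) (Fin N) ℂ) (f : MatPoly N) :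
    evalMat X (rightTrans M f) = evalMat (X * M) f := by
  have : (evalMat X).comp (rightTrans M) = evalMat (X * M) := by
    refine MvPolynomial.algHom_ext fun p => ?_
    simp only [AlgHom.comp_apply, rightTrans_X, map_sum, map_mul, evalMat_X, Matrix.mul_apply]
    exact Finset.sum_congr rfl fun c _ => by simp [evalMat, mul_comm]
  rw [← this, AlgHom.comp_apply]

theorem matPoly_ext {N : ℕ} {f g : MatPoly N} (h : ∀ X, evalMat X f = evalMat X g) : f = g := by
  refine MvPolynomial.funext fun x => ?_
  simpa [evalMat, MvPolynomial.aeval_eq_eval] using h (Matrix.of fun i j => x (i, j))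

theorem rightTrans_one {N : ℕ} (f : MatPoly N) : rightTrans 1 f = f :=
  matPoly_ext fun X => by rw [evalMat_rightTrans, mul_one]

theorem leftDeriv_rightTrans {N : ℕ} (i j : Fin N) (M : Matrix (Fin N) (Fin N) ℂ)
    (f : MatPoly N) : leftDeriv i j (rightTrans M f) = rightTrans M (leftDeriv i j f) := by
  induction f using MvPolynomial.induction_on with
  | C a =>
    rw [← MvPolynomial.algebraMap_eq, AlgHom.commutes, Derivation.map_algebraMap, map_zero]
  | add p q hp hq => simp only [map_add, hp, hq]
  | mul_X p q hp =>
    have hX : leftDeriv i j (rightTrans M (MvPolynomial.X q)) =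
        rightTrans M (leftDeriv i j (MvPolynomial.X q)) := by
      rw [rightTrans_X, leftDeriv_X, map_sum]
      simp only [← MvPolynomial.smul_eq_C_mul, Derivation.map_smul, leftDeriv_X]
      split_ifs
      · rw [rightTrans_X]
        simp only [MvPolynomial.smul_eq_C_mul]
      · simp
    simp only [map_mul, Derivation.leibniz, map_add, smul_eq_mul, hp, hX]

theorem casimir_rightTrans {N : ℕ} (M : Matrix (Fin N) (Fin N) ℂ) (f : MatPoly N) :
    casimir N (rightTrans M f) = rightTrans M (casimir N f) := by
  simp only [casimir_apply, leftDeriv_rightTrans, map_add, map_sum, map_smul]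

/-- All right translates of `f` have dominated restriction to the diagonal. -/
def StronglyDominated {N : ℕ} (l : Fin N → ℕ) (f : MatPoly N) : Prop :=
  ∀ M, Dominated l (diagRes N (rightTrans M f))

theorem StronglyDominated.mul {N : ℕ} {l m : Fin N → ℕ} {f g : MatPoly N}
    (hf : StronglyDominated l f) (hg : StronglyDominated m g) :
    StronglyDominated (l + m) (f * g) := fun M => by
  rw [map_mul, map_mul]
  exact (hf M).mul (hg M)

theorem StronglyDominated.dominated {N : ℕ} {l : Fin N → ℕ} {f : MatPoly N}
    (hf : StronglyDominated l f) : Dominated l (diagRes N f) := by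
  simpa [rightTrans_one] using hf 1

/-- The sum of the principal `k × k` minors. -/
def minorSum (N k : ℕ) : MatPoly N :=
  ∑ s ∈ (Finset.univ : Finset (Fin N)).powersetCard k,
    ((genMat N).submatrix (Subtype.val : s → Fin N) (Subtype.val : s → Fin N)).det

theorem evalMat_minorSum {N k : ℕ} (hk : k ≤ N) (X : Matrix (Fin N) (Fin N) ℂ) :
    evalMat X (minorSum N k) = (-1) ^ k * X.charpoly.coeff (N - k) := by
  have h := X.charpoly_coeff_eq_sum_minors k (by simpa using hk)
  rw [Fintype.card_fin] at h
  rw [h, ← mul_assoc, ← mul_pow, neg_one_mul, neg_neg, one_pow, one_mul, minorSum, map_sum]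
  refine Finset.sum_congr rfl fun s _ => ?_
  rw [AlgHom.map_det]
  conv_rhs => rw [← map_genMat X]
  rfl

theorem isClass_minorSum {N k : ℕ} (hk : k ≤ N) : IsClass (minorSum N k) := by
  intro U X
  rw [evalMat_minorSum hk, evalMat_minorSum hk, mul_assoc, Matrix.charpoly_mul_comm, mul_assoc,
    Unitary.mul_star_self_of_mem U.2, mul_one]

theorem diagRes_rightTrans_minor {N : ℕ} (M : Matrix (Fin N) (Fin N) ℂ) (s : Finset (Fin N)) :
    diagRes N (rightTrans M
      ((genMat N).submatrix (Subtype.val : s → Fin N) (Subtype.val : s → Fin N)).det) =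
      MvPolynomial.C (M.submatrix (Subtype.val : s → Fin N) (Subtype.val : s → Fin N)).det *
        expMonomial (fun i => if i ∈ s then 1 else 0) := by
  have h := Matrix.det_mul_column (fun i : s => (MvPolynomial.X i.1 : MvPolynomial (Fin N) ℂ))
    ((M.submatrix (Subtype.val : s → Fin N) (Subtype.val : s → Fin N)).map MvPolynomial.C)
  rw [AlgHom.map_det, AlgHom.map_det, RingHom.map_det, expMonomial_eq_prod]
  have h2 : ∏ i, (MvPolynomial.X i : MvPolynomial (Fin N) ℂ) ^ (if i ∈ s then 1 else 0) =
      ∏ i : s, MvPolynomial.X i.1 := by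
    rw [Finset.prod_coe_sort s (fun i => (MvPolynomial.X i : MvPolynomial (Fin N) ℂ))]
    simp [pow_ite, Finset.prod_ite_mem]
  rw [h2, mul_comm]
  refine Eq.trans ?_ h
  congr 1
  ext1 a b
  simp only [AlgHom.mapMatrix_apply, Matrix.map_apply, Matrix.submatrix_apply, genMat_apply,
    rightTrans_X, map_sum, map_mul, Matrix.of_apply]
  rw [Finset.sum_eq_single a.1]
  · simp [diagRes, mul_comm]
  · intro c _ hc
    simp [diagRes, Ne.symm hc]
  · simp

theorem initialSum_indicator {N : ℕ} {k n : ℕ} (hn : n ≤ N) :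
    initialSum (fun i : Fin N => if i.val < k then 1 else 0) n = min k n := by
  unfold initialSum
  rw [Finset.sum_boole, Finset.filter_filter]
  simp only [← lt_min_iff, Nat.cast_id]
  rw [card_filter_val_lt (by omega), min_comm]

theorem stronglyDominated_minorSum {N : ℕ} (k : ℕ) :
    StronglyDominated (fun i : Fin N => if i.val < k then 1 else 0) (minorSum N k) := by
  intro M
  rw [dominated_iff]
  intro β hβ
  rw [minorSum, map_sum, map_sum, MvPolynomial.coeff_sum]
  refine Finset.sum_eq_zero fun s hs => ?_
  rw [diagRes_rightTrans_minor, MvPolynomial.coeff_C_mul, expMonomial, MvPolynomial.coeff_monomial,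
    if_neg, mul_zero]
  rintro rfl
  refine hβ fun S => ?_
  rw [initialSum_indicator (by simpa using S.card_le_univ)]
  simp only [Finsupp.equivFunOnFinite_symm_apply_apply, Finset.sum_boole, Nat.cast_id]
  rw [Finset.mem_powersetCard] at hs
  refine le_min ?_ (Finset.card_filter_le _ _)
  rw [← hs.2]
  exact Finset.card_le_card fun i hi => (Finset.mem_filter.1 hi).2

theorem coeff_diagRes_minorSum {N k : ℕ} (hk : k ≤ N) :
    (diagRes N (minorSum N k)).coeff
      (Finsupp.equivFunOnFinite.symm fun i : Fin N => if i.val < k then 1 else 0) = 1 := by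
  rw [← rightTrans_one (minorSum N k), minorSum, map_sum, map_sum, MvPolynomial.coeff_sum,
    Finset.sum_eq_single (Finset.univ.filter fun i : Fin N => i.val < k)]
  · rw [diagRes_rightTrans_minor, MvPolynomial.coeff_C_mul, expMonomial,
      MvPolynomial.coeff_monomial, if_pos, Matrix.submatrix_one _ Subtype.val_injective,
      Matrix.det_one, one_mul]
    congr 1
    ext i
    simp
  · intro s _ hs
    rw [diagRes_rightTrans_minor, MvPolynomial.coeff_C_mul, expMonomial,
      MvPolynomial.coeff_monomial, if_neg, mul_zero]
    intro h
    apply hs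
    ext i
    have := congrFun (Finsupp.equivFunOnFinite.symm.injective h) i
    rw [Finset.mem_filter]
    by_cases h1 : i ∈ s <;> by_cases h2 : i.val < k <;> simp_all
  · intro h
    exact absurd (Finset.mem_powersetCard.2 ⟨Finset.subset_univ _, card_filter_val_lt hk⟩) h

/-- Products of elementary symmetric functions, triangular with respect to dominance. -/
theorem exists_stronglyDominated {N : ℕ} {l : Fin N → ℕ} (hl : Antitone l) :
    ∃ P : MatPoly N, IsClass P ∧ StronglyDominated l P ∧
      (diagRes N P).coeff (Finsupp.equivFunOnFinite.symm l) = 1 := by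
  induction h : ∑ i, l i using Nat.strong_induction_on generalizing l with
  | _ n ih =>
    rcases Nat.eq_zero_or_pos n with rfl | hn
    · have hl0 : l = 0 := funext fun i => Finset.sum_eq_zero_iff.1 h i (Finset.mem_univ i)
      subst hl0
      refine ⟨1, fun U X => by simp, fun M => ?_, by simp [MvPolynomial.coeff_one, Finsupp.ext_iff]⟩
      intro β hβ S
      have : β = 0 := by
        rw [map_one, map_one, MvPolynomial.mem_support_iff, MvPolynomial.coeff_one] at hβ
        by_contra hne
        simp [Ne.symm hne] at hβ
      subst this
      simp
    · set k := (Finset.univ.filter fun i => 0 < l i).card with hk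
      have hkN : k ≤ N := by simpa using Finset.card_le_univ (Finset.univ.filter fun i => 0 < l i)
      have hlk : ∀ i, 0 < l i ↔ i.val < k := by
        intro i
        constructor
        · intro hi
          have : (Finset.univ.filter fun j : Fin N => j.val < i + 1) ⊆
              Finset.univ.filter fun i => 0 < l i := by
            intro j hj
            simp only [Finset.mem_filter, Finset.mem_univ, true_and] at hj ⊢
            exact lt_of_lt_of_le hi (hl (Fin.le_def.2 (by omega)))
          have := Finset.card_le_card this
          rw [card_filter_val_lt (by omega)] at this
          omega
        · intro hi
          by_contra hi0
          have : (Finset.univ.filter fun i => 0 < l i) ⊆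
              Finset.univ.filter fun j : Fin N => j.val < i := by
            intro j hj
            simp only [Finset.mem_filter, Finset.mem_univ, true_and] at hj ⊢
            by_contra hji
            have := hl (Fin.le_def.2 (not_lt.1 hji))
            omega
          have := Finset.card_le_card this
          rw [card_filter_val_lt (by omega)] at this
          omega
      have hsum : l = (fun i => l i - 1) + fun i : Fin N => if i.val < k then 1 else 0 := by
        funext i
        have := hlk i
        simp only [Pi.add_apply]
        split_ifs with h1
        · have := (hlk i).2 h1
          omega
        · omega
      have hlt : ∑ i, (l i - 1) < n := by
        rw [← h]
        obtain ⟨i, -, hi⟩ : ∃ i ∈ Finset.univ, 0 < l i := by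
          by_contra hc
          push Not at hc
          have := Finset.sum_eq_zero fun i hi => Nat.le_zero.1 (hc i hi)
          omega
        exact Finset.sum_lt_sum (fun i _ => Nat.sub_le _ _) ⟨i, Finset.mem_univ _, by omega⟩
      obtain ⟨P, hP1, hP2, hP3⟩ := ih _ hlt (l := fun i => l i - 1)
        (fun i j hij => Nat.sub_le_sub_right (hl hij) 1) rfl
      refine ⟨P * minorSum N k, hP1.mul (isClass_minorSum hkN), ?_, ?_⟩
      · rw [hsum]
        exact hP2.mul (stronglyDominated_minorSum k)
      · rw [hsum, map_mul,
          hP2.dominated.coeff_mul (stronglyDominated_minorSum k).dominated, hP3,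
          coeff_diagRes_minorSum hkN, one_mul]

theorem casimir_schurPoly_mem {N : ℕ} (α : Fin N → ℕ) :
    schurPoly α ∈ (casimir N).eigenspace
      (∑ i, (α i : ℂ) ^ 2 - ∑ i, (stair N i : ℂ) ^ 2) :=
  Module.End.mem_eigenspace_iff.2 (casimir_schurPoly α)

/-- A dominated class polynomial has only one Schur component of extremal Casimir eigenvalue. -/
theorem IsClass.sub_smul_mem_iSup {N : ℕ} {l : Fin N → ℕ} (hl : Antitone l) {f : MatPoly N}
    (hf : IsClass f) (hd : Dominated l (diagRes N f)) :
    f - (diagRes N f).coeff (Finsupp.equivFunOnFinite.symm l) • schurPoly (stair N + l) ∈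
      ⨆ c, ⨆ (_ : c ≠ ∑ i, ((stair N i + l i : ℕ) : ℂ) ^ 2 - ∑ i, (stair N i : ℂ) ^ 2),
        (casimir N).eigenspace c := by
  set τ := stair N + l with hτ
  set E := ⨆ c, ⨆ (_ : c ≠ ∑ i, ((stair N i + l i : ℕ) : ℂ) ^ 2 - ∑ i, (stair N i : ℂ) ^ 2),
        (casimir N).eigenspace c with hE
  have hτanti : StrictAnti τ := strictAnti_stair_add hl
  have hstair : Dominated (stair N) (altPoly (stair N)) :=
    dominated_altPoly (strictAnti_stair N).antitone
  have hcoeff : (altPoly (stair N) * diagRes N f).coeff (Finsupp.equivFunOnFinite.symm τ) =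
      (diagRes N f).coeff (Finsupp.equivFunOnFinite.symm l) := by
    rw [hτ, hstair.coeff_mul hd,
      coeff_altPoly_of_strictAnti (strictAnti_stair N) (strictAnti_stair N), if_pos rfl, one_mul]
  set κ : (Fin N →₀ ℕ) → ℂ := fun β =>
    (altPoly (stair N + ⇑β)).coeff (Finsupp.equivFunOnFinite.symm τ) with hκ
  have hβ : ∀ β ∈ (diagRes N f).support, schurPoly (stair N + ⇑β) - κ β • schurPoly τ ∈ E := by
    intro β hβ
    by_cases hn : ∑ i, (stair N + ⇑β) i ^ 2 = ∑ i, τ i ^ 2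
    · obtain ⟨σ, hσ⟩ := exists_eq_comp_perm (fun S => by
        have h1 := sum_le_initialSum (strictAnti_stair N).antitone S
        have h2 := hd β hβ S
        rw [hτ, initialSum_add]
        simp only [Pi.add_apply, Finset.sum_add_distrib]
        exact add_le_add h1 h2) hn
      have : κ β = ((Equiv.Perm.sign σ : ℤ) : ℂ) := by
        simp only [hκ]
        rw [hσ, altPoly_comp_perm, MvPolynomial.coeff_C_mul,
          coeff_altPoly_of_strictAnti hτanti hτanti, if_pos rfl, mul_one]
      rw [this, hσ, schurPoly_comp_perm, sub_self]
      exact zero_mem _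
    · have : κ β = 0 := by
        simp only [hκ]
        rw [coeff_altPoly]
        refine Finset.sum_eq_zero fun σ _ => if_neg fun h => hn ?_
        rw [h]
        exact (Equiv.sum_comp σ (fun i => (stair N + ⇑β) i ^ 2)).symm
      rw [this, zero_smul, sub_zero]
      refine Submodule.mem_iSup_of_mem _ (Submodule.mem_iSup_of_mem ?_ (casimir_schurPoly_mem _))
      intro h
      apply hn
      have h' := sub_left_injective h
      exact_mod_cast h'
  have hsum : (diagRes N f).coeff (Finsupp.equivFunOnFinite.symm l) =
      ∑ β ∈ (diagRes N f).support, (diagRes N f).coeff β * κ β := by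
    rw [← hcoeff, mul_comm, symmetric_mul_altPoly hf.isSymmetric, MvPolynomial.coeff_sum]
    simp only [MvPolynomial.coeff_C_mul, hκ]
  rw [hsum, Finset.sum_smul]
  nth_rewrite 1 [hf.eq_sum_schurPoly]
  rw [← Finset.sum_sub_distrib]
  refine sum_mem fun β h => ?_
  rw [mul_smul, ← smul_sub]
  exact Submodule.smul_mem _ _ (hβ β h)

instance (N : ℕ) : BorelSpace (UN N) := ⟨rfl⟩

instance (N : ℕ) : CompactSpace (UN N) := by
  have h1 : IsCompact (Set.univ.pi fun _ : Fin N => Set.univ.pi fun _ : Fin N =>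
      Metric.closedBall (0 : ℂ) 1) :=
    isCompact_univ_pi fun _ => isCompact_univ_pi fun _ => isCompact_closedBall 0 1
  have h2 : IsClosed (Matrix.unitaryGroup (Fin N) ℂ : Set (Matrix (Fin N) (Fin N) ℂ)) :=
    isClosed_unitary
  refine isCompact_iff_compactSpace.1 (h1.of_isClosed_subset h2 ?_)
  intro U hU i _ j _
  rw [mem_closedBall_zero_iff]
  exact entry_norm_bound_of_unitary hU i j

theorem eq_of_isMulLeftInvariant {N : ℕ} (μ ν : Measure (UN N)) [μ.IsHaarMeasure]
    [IsProbabilityMeasure μ] [ν.IsMulLeftInvariant] [IsProbabilityMeasure ν] : ν = μ := by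
  have h := Measure.isMulInvariant_eq_smul_of_compactSpace ν μ
  have h1 : ν Set.univ = μ Set.univ := by rw [measure_univ, measure_univ]
  rw [h, Measure.smul_apply, measure_univ, ENNReal.smul_def, smul_eq_mul, mul_one] at h1
  rw [ENNReal.coe_eq_one] at h1
  rw [h, h1, one_smul]

instance {N : ℕ} (μ : Measure (UN N)) [μ.IsHaarMeasure] [IsProbabilityMeasure μ] :
    μ.IsMulRightInvariant := by
  refine ⟨fun g => ?_⟩
  have : IsProbabilityMeasure (μ.map (· * g)) :=
    Measure.isProbabilityMeasure_map (measurable_mul_const g).aemeasurable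
  exact eq_of_isMulLeftInvariant μ _

instance {N : ℕ} (μ : Measure (UN N)) [μ.IsHaarMeasure] [IsProbabilityMeasure μ] :
    μ.IsInvInvariant := by
  refine ⟨?_⟩
  have : IsProbabilityMeasure μ.inv :=
    Measure.isProbabilityMeasure_map measurable_inv.aemeasurable
  exact eq_of_isMulLeftInvariant μ _

theorem continuous_evalMat {N : ℕ} {Ω : Type*} [TopologicalSpace Ω]
    {φ : Ω → Matrix (Fin N) (Fin N) ℂ} (hφ : Continuous φ) (f : MatPoly N) :
    Continuous fun U => evalMat (φ U) f := by
  simp only [evalMat, MvPolynomial.aeval_eq_eval]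
  exact (MvPolynomial.continuous_eval f).comp
    (continuous_pi fun p => (continuous_apply_apply p.1 p.2).comp hφ)

theorem integrable_of_continuous {N : ℕ} (μ : Measure (UN N)) [IsProbabilityMeasure μ]
    {f : UN N → ℂ} (hf : Continuous f) : Integrable f μ :=
  hf.integrable_of_hasCompactSupport (HasCompactSupport.of_compactSpace f)

/-- The comultiplication `f ↦ f (X * M)`, as a polynomial in `X` whose coefficients are
polynomials in `M`. -/
def coaction (N : ℕ) : MatPoly N →ₐ[ℂ] MvPolynomial (Fin N × Fin N) (MatPoly N) :=
  MvPolynomial.aeval fun p =>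
    ∑ c, MvPolynomial.C (MvPolynomial.X (c, p.2)) * MvPolynomial.X (p.1, c)

theorem map_coaction {N : ℕ} (M : Matrix (Fin N) (Fin N) ℂ) (f : MatPoly N) :
    MvPolynomial.map (evalMat M : MatPoly N →+* ℂ) (coaction N f) = rightTrans M f := by
  have : (MvPolynomial.mapAlgHom (evalMat M)).comp (coaction N) = rightTrans M := by
    refine MvPolynomial.algHom_ext fun p => ?_
    simp [coaction, rightTrans_X, evalMat_X]
  rw [← this]
  rfl

/-- Weighted averages of right translations, as linear operators. -/
theorem exists_average {N : ℕ} (μ : Measure (UN N)) [IsProbabilityMeasure μ]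
    {w : UN N → ℂ} (hw : Continuous w) {φ : UN N → Matrix (Fin N) (Fin N) ℂ}
    (hφ : Continuous φ) :
    ∃ T : MatPoly N →ₗ[ℂ] MatPoly N, ∀ (L : MatPoly N →ₗ[ℂ] ℂ) (f : MatPoly N),
      L (T f) = ∫ U, w U * L (rightTrans (φ U) f) ∂μ := by
  have hint : ∀ g : MatPoly N, Integrable (fun U => w U * evalMat (φ U) g) μ := fun g =>
    integrable_of_continuous μ (hw.mul (continuous_evalMat hφ g))
  let I : MatPoly N →ₗ[ℂ] ℂ :=
    { toFun := fun g => ∫ U, w U * evalMat (φ U) g ∂μ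
      map_add' := fun g h => by
        simp only [map_add, mul_add]
        exact integral_add (hint g) (hint h)
      map_smul' := fun c g => by
        simp only [map_smul, smul_eq_mul, mul_left_comm, RingHom.id_apply]
        exact integral_const_mul c _ }
  have hI : ∀ g, I g = ∫ U, w U * evalMat (φ U) g ∂μ := fun g => rfl
  let T₀ : MatPoly N → MatPoly N := fun f =>
    ∑ β ∈ (coaction N f).support, MvPolynomial.monomial β (I ((coaction N f).coeff β))
  have hT : ∀ f β, (T₀ f).coeff β = I ((coaction N f).coeff β) := by
    intro f β
    simp only [T₀, MvPolynomial.coeff_sum, MvPolynomial.coeff_monomial, Finset.sum_ite_eq']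
    split_ifs with h
    · rfl
    · rw [MvPolynomial.notMem_support_iff.1 h, map_zero]
  refine ⟨{ toFun := T₀, map_add' := fun f g => ?_, map_smul' := fun c f => ?_ }, fun L f => ?_⟩
  · ext β
    simp only [hT, map_add, MvPolynomial.coeff_add]
  · ext β
    simp only [hT, map_smul, MvPolynomial.coeff_smul, RingHom.id_apply]
  · have hL : ∀ U, rightTrans (φ U) f = ∑ β ∈ (coaction N f).support,
        evalMat (φ U) ((coaction N f).coeff β) • MvPolynomial.monomial β (1 : ℂ) := by
      intro U
      rw [← map_coaction]
      conv_lhs => rw [(coaction N f).as_sum]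
      rw [map_sum]
      refine Finset.sum_congr rfl fun β _ => ?_
      rw [MvPolynomial.map_monomial, MvPolynomial.smul_monomial, smul_eq_mul, mul_one]
      rfl
    simp only [hL, map_sum, map_smul, smul_eq_mul, Finset.mul_sum]
    rw [integral_finsetSum]
    · change L (T₀ f) = _
      simp only [T₀, map_sum]
      refine Finset.sum_congr rfl fun β _ => ?_
      simp only [← mul_assoc]
      rw [integral_mul_const, ← hI, ← smul_eq_mul, ← map_smul, MvPolynomial.smul_monomial,
        smul_eq_mul, mul_one]
    · intro β _
      simp only [← mul_assoc]
      exact (hint _).mul_const _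

/-- Averaging against a class function acts on Schur polynomials by scalars. -/
theorem exists_integral_mul_schurPoly {N : ℕ} (μ : Measure (UN N)) [μ.IsHaarMeasure]
    [IsProbabilityMeasure μ] {w : UN N → ℂ} (hw : Continuous w)
    (hw' : ∀ U V, w (V * U * V⁻¹) = w U) {l : Fin N → ℕ} (hl : Antitone l) :
    ∃ d : ℂ, ∀ X, ∫ U : UN N, w U * evalMat (X * (U : Matrix (Fin N) (Fin N) ℂ))
      (schurPoly (stair N + l)) ∂μ = d * evalMat X (schurPoly (stair N + l)) := by
  obtain ⟨T, hT⟩ := exists_average μ hw (φ := fun U : UN N => (U : Matrix (Fin N) (Fin N) ℂ))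
    continuous_subtype_val
  have hTeval : ∀ X f, evalMat X (T f) = ∫ U : UN N, w U *
      evalMat (X * (U : Matrix (Fin N) (Fin N) ℂ)) f ∂μ := fun X f => by
    have := hT (evalMat X).toLinearMap f
    simpa only [AlgHom.toLinearMap_apply, evalMat_rightTrans] using this
  have hcas : ∀ f, casimir N (T f) = T (casimir N f) := fun f => by
    ext β
    have h1 := hT (MvPolynomial.lcoeff ℂ β ∘ₗ casimir N) f
    have h2 := hT (MvPolynomial.lcoeff ℂ β) (casimir N f)
    simp only [LinearMap.comp_apply, casimir_rightTrans] at h1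
    rw [← h2] at h1
    exact h1
  have hclass : ∀ f, IsClass f → IsClass (T f) := fun f hf V X => by
    rw [hTeval, hTeval]
    conv_rhs => rw [← integral_mul_right_eq_self _ V⁻¹, ← integral_mul_left_eq_self _ V]
    refine integral_congr_ae (Filter.Eventually.of_forall fun U => ?_)
    simp only [hw']
    rw [← hf V (X * _)]
    congr 3
    have := Unitary.star_mul_self_of_mem V.2
    simp only [Submonoid.coe_mul, Matrix.UnitaryGroup.inv_val, mul_assoc, this,
      mul_one]
  have hdom : ∀ f, StronglyDominated l f → Dominated l (diagRes N (T f)) := fun f hf => by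
    rw [dominated_iff]
    intro β hβ
    have h1 := hT (MvPolynomial.lcoeff ℂ β ∘ₗ (diagRes N).toLinearMap) f
    have h2 : ∀ M, (diagRes N (rightTrans M f)).coeff β = 0 := fun M =>
      dominated_iff.1 (hf M) β hβ
    simp only [LinearMap.comp_apply, AlgHom.toLinearMap_apply, MvPolynomial.lcoeff_apply, h2,
      mul_zero, integral_zero] at h1
    exact h1
  set c := ∑ i, ((stair N i + l i : ℕ) : ℂ) ^ 2 - ∑ i, (stair N i : ℂ) ^ 2 with hc
  set E := ⨆ a, ⨆ (_ : a ≠ c), (casimir N).eigenspace a with hE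
  have hTeig : ∀ a, ∀ f ∈ (casimir N).eigenspace a, T f ∈ (casimir N).eigenspace a := by
    intro a f hf
    rw [Module.End.mem_eigenspace_iff] at hf ⊢
    rw [hcas, hf, map_smul]
  have hTE : E ≤ E.comap T := iSup₂_le fun a ha f hf =>
    Submodule.mem_iSup_of_mem a (Submodule.mem_iSup_of_mem ha (hTeig a f hf))
  obtain ⟨P, hP1, hP2, hP3⟩ := exists_stronglyDominated hl
  have h1 := hP1.sub_smul_mem_iSup hl hP2.dominated
  rw [hP3, one_smul] at h1
  have h2 := (hclass P hP1).sub_smul_mem_iSup hl (hdom P hP2)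
  set d := (diagRes N (T P)).coeff (Finsupp.equivFunOnFinite.symm l) with hd
  have h3 : T (schurPoly (stair N + l)) - d • schurPoly (stair N + l) ∈ E := by
    have := sub_mem h2 (hTE h1)
    rw [map_sub] at this
    rwa [sub_sub_sub_cancel_left] at this
  have h4 : T (schurPoly (stair N + l)) - d • schurPoly (stair N + l) ∈
      (casimir N).eigenspace c :=
    sub_mem (hTeig _ _ (casimir_schurPoly_mem _))
      (Submodule.smul_mem _ _ (casimir_schurPoly_mem _))
  have h5 := Submodule.disjoint_def.1 ((casimir N).eigenspaces_iSupIndep c) _ h4 h3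
  refine ⟨d, fun X => ?_⟩
  rw [← hTeval, sub_eq_zero.1 h5, map_smul, smul_eq_mul]

theorem evalMat_schurPoly_mul_comm {N : ℕ} (α : Fin N → ℕ) (X Y : Matrix (Fin N) (Fin N) ℂ) :
    evalMat (X * Y) (schurPoly α) = evalMat (Y * X) (schurPoly α) := by
  have key : ∀ f ∈ traceAlg N, evalMat (X * Y) f = evalMat (Y * X) f := by
    intro f hf
    induction hf using Algebra.adjoin_induction with
    | mem x hx =>
      obtain ⟨k, rfl⟩ := hx
      rw [evalMat_powerTrace, evalMat_powerTrace]
      cases k with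
      | zero => simp
      | succ k =>
        have h : Y * (X * Y) ^ k = (Y * X) ^ k * Y :=
          SemiconjBy.pow_right (mul_assoc Y X Y).symm k
        rw [pow_succ', mul_assoc, h, Matrix.trace_mul_comm, mul_assoc, ← pow_succ]
    | algebraMap r => simp
    | add x y _ _ hx hy => simp [hx, hy]
    | mul x y _ _ hx hy => simp [hx, hy]
  exact key _ (schurPoly_mem α)

theorem continuous_star_unitary {N : ℕ} :
    Continuous fun U : UN N => star (U : Matrix (Fin N) (Fin N) ℂ) :=
  continuous_star.comp continuous_subtype_val

theorem exists_integral_schurPoly_mul {N : ℕ} (μ : Measure (UN N)) [μ.IsHaarMeasure]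
    [IsProbabilityMeasure μ] {l : Fin N → ℕ} (hl : Antitone l) (m : Fin N → ℕ) :
    ∃ d : ℂ, ∀ X, ∫ U : UN N, evalMat (star (U : Matrix (Fin N) (Fin N) ℂ))
      (schurPoly (stair N + m)) * evalMat (X * (U : Matrix (Fin N) (Fin N) ℂ))
      (schurPoly (stair N + l)) ∂μ = d * evalMat X (schurPoly (stair N + l)) := by
  refine exists_integral_mul_schurPoly μ (continuous_evalMat continuous_star_unitary _) ?_ hl
  intro U V
  have h := isClass_schurPoly (stair N + m) V⁻¹ (star (U : Matrix (Fin N) (Fin N) ℂ))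
  rw [← h]
  congr 2
  simp [star_mul, mul_assoc]

/-- Orthogonality of Schur polynomials. -/
theorem integral_schurPoly_mul_of_ne {N : ℕ} (μ : Measure (UN N)) [μ.IsHaarMeasure]
    [IsProbabilityMeasure μ] {l m : Fin N → ℕ} (hl : Antitone l) (hm : Antitone m) (hlm : l ≠ m)
    (X : Matrix (Fin N) (Fin N) ℂ) :
    ∫ U : UN N, evalMat (star (U : Matrix (Fin N) (Fin N) ℂ))
      (schurPoly (stair N + m)) * evalMat (X * (U : Matrix (Fin N) (Fin N) ℂ))
      (schurPoly (stair N + l)) ∂μ = 0 := by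
  obtain ⟨d, hd⟩ := exists_integral_schurPoly_mul μ hl m
  obtain ⟨d', hd'⟩ := exists_integral_schurPoly_mul μ hm l
  have h1 : ∀ V : UN N, d * evalMat (V : Matrix (Fin N) (Fin N) ℂ) (schurPoly (stair N + l)) =
      d' * evalMat (V : Matrix (Fin N) (Fin N) ℂ) (schurPoly (stair N + m)) := by
    intro V
    rw [← hd, ← hd', ← integral_mul_left_eq_self _ V⁻¹, ← integral_inv_eq_self]
    refine integral_congr_ae (Filter.Eventually.of_forall fun U => ?_)
    have h2 := Unitary.mul_star_self_of_mem V.2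
    simp only [Submonoid.coe_mul, Matrix.UnitaryGroup.inv_val, star_mul, star_star]
    rw [mul_comm, ← mul_assoc, h2, one_mul,
      evalMat_schurPoly_mul_comm _ (U : Matrix (Fin N) (Fin N) ℂ)]
  have h3 : d • schurPoly (stair N + l) = d' • schurPoly (stair N + m) := by
    rw [← sub_eq_zero]
    refine matPoly_eq_zero_of_unitary fun V => ?_
    rw [map_sub, map_smul, map_smul, smul_eq_mul, smul_eq_mul, h1 V, sub_self]
  have h4 := congrArg (fun f => (altPoly (stair N) * diagRes N f).coeff
    (Finsupp.equivFunOnFinite.symm (stair N + l))) h3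
  simp only [map_smul, mul_smul_comm, altPoly_stair_mul_diagRes_schurPoly,
    MvPolynomial.coeff_smul, coeff_altPoly_of_strictAnti (strictAnti_stair_add hl) (strictAnti_stair_add hl),
    coeff_altPoly_of_strictAnti (strictAnti_stair_add hm) (strictAnti_stair_add hl), if_true, add_right_inj, if_neg hlm,
    smul_eq_mul, mul_one, mul_zero] at h4
  rw [hd, h4, zero_mul]

theorem isHomogeneous_genMat_pow {N : ℕ} (k : ℕ) (a b : Fin N) :
    ((genMat N ^ k) a b).IsHomogeneous k := by
  induction k generalizing a b with
  | zero =>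
    rw [pow_zero, Matrix.one_apply]
    split_ifs
    · exact MvPolynomial.isHomogeneous_one _ _
    · exact MvPolynomial.isHomogeneous_zero _ _ _
  | succ k ih =>
    rw [pow_succ, Matrix.mul_apply]
    exact MvPolynomial.IsHomogeneous.sum _ _ _ fun c _ =>
      (ih a c).mul (MvPolynomial.isHomogeneous_X _ _)

theorem isHomogeneous_hPoly (N k : ℕ) : (hPoly N k).IsHomogeneous k := by
  induction k using Nat.strong_induction_on with
  | _ k ih =>
    cases k with
    | zero => rw [hPoly]; exact MvPolynomial.isHomogeneous_one _ _
    | succ k =>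
      rw [hPoly, MvPolynomial.smul_eq_C_mul]
      refine MvPolynomial.IsHomogeneous.C_mul (MvPolynomial.IsHomogeneous.sum _ _ _ fun m hm => ?_) _
      have hm' := Finset.mem_range.1 hm
      have h : powerTrace N (m + 1) |>.IsHomogeneous (m + 1) :=
        MvPolynomial.IsHomogeneous.sum _ _ _ fun a _ => isHomogeneous_genMat_pow _ a a
      have h2 := h.mul (ih (k - m) (by omega))
      rwa [show m + 1 + (k - m) = k + 1 by omega] at h2

theorem isHomogeneous_schurPoly {N : ℕ} (l : Fin N → ℕ) :
    (schurPoly (stair N + l)).IsHomogeneous (∑ i, l i) := by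
  unfold schurPoly jacobiTrudi
  rw [Matrix.det_apply']
  refine MvPolynomial.IsHomogeneous.sum _ _ _ fun σ _ => ?_
  have hC : ((Equiv.Perm.sign σ : ℤ) : MatPoly N) = MvPolynomial.C ((Equiv.Perm.sign σ : ℤ) : ℂ) := by
    simp
  rw [hC]
  refine MvPolynomial.IsHomogeneous.C_mul ?_ _
  simp only [Matrix.of_apply]
  by_cases h : ∃ i, (((stair N + l) (σ i) : ℕ) : ℤ) - (N - 1) + (i : ℕ) < 0
  · obtain ⟨i, hi⟩ := h
    rw [Finset.prod_eq_zero (Finset.mem_univ i)]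
    · exact MvPolynomial.isHomogeneous_zero _ _ _
    · rw [extendZero, if_pos hi]
  · push Not at h
    have h1 : ∑ i, ((((stair N + l) (σ i) : ℕ) : ℤ) - (N - 1) + (i : ℕ)).toNat = ∑ i, l i := by
      zify
      rw [Finset.sum_congr rfl fun i _ => Int.toNat_of_nonneg (h i)]
      simp only [Pi.add_apply, Nat.cast_add, stair_cast]
      have h2 : ∑ i, ((σ i : ℕ) : ℤ) = ∑ i : Fin N, ((i : ℕ) : ℤ) :=
        Equiv.sum_comp σ fun i => ((i : ℕ) : ℤ)
      have h3 : ∑ i, (l (σ i) : ℤ) = ∑ i, (l i : ℤ) := Equiv.sum_comp σ fun i => (l i : ℤ)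
      rw [← h3]
      simp only [Finset.sum_add_distrib, Finset.sum_sub_distrib, h2]
      ring
    rw [← h1]
    refine MvPolynomial.IsHomogeneous.prod _ _ _ fun i _ => ?_
    rw [extendZero, if_neg (not_lt.2 (h i))]
    exact isHomogeneous_hPoly _ _

theorem coeff_altPoly_comp_perm {N : ℕ} (α β : Fin N → ℕ) (σ : Equiv.Perm (Fin N)) :
    (altPoly α).coeff (Finsupp.equivFunOnFinite.symm (β ∘ σ)) =
      ((Equiv.Perm.sign σ : ℤ) : ℂ) * (altPoly α).coeff (Finsupp.equivFunOnFinite.symm β) := by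
  rw [coeff_altPoly, coeff_altPoly, Finset.mul_sum]
  refine (Fintype.sum_equiv (Equiv.mulRight σ) _ _ fun π => ?_).symm
  have h : β ∘ σ = α ∘ ⇑(Equiv.mulRight σ π) ↔ β = α ∘ π := by
    simp only [Equiv.coe_mulRight, Equiv.Perm.coe_mul, ← Function.comp_assoc]
    exact σ.surjective.injective_comp_right.eq_iff
  simp only [h]
  split_ifs
  · simp [mul_comm]
  · simp

theorem coeff_altPoly_eq_zero {N : ℕ} {α β : Fin N → ℕ} (hα : Function.Injective α)
    (hβ : ¬ Function.Injective β) :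
    (altPoly α).coeff (Finsupp.equivFunOnFinite.symm β) = 0 := by
  rw [coeff_altPoly]
  refine Finset.sum_eq_zero fun σ _ => if_neg ?_
  rintro rfl
  exact hβ (hα.comp σ.injective)

theorem exists_eq_stair_add {N : ℕ} {α : Fin N → ℕ} (hα : StrictAnti α) :
    ∃ l : Fin N → ℕ, Antitone l ∧ α = stair N + l := by
  have h1 : ∀ i j : Fin N, i ≤ j → α j + (j - i : ℕ) ≤ α i := by
    intro i j hij
    obtain ⟨k, hk⟩ := Nat.exists_eq_add_of_le (Fin.le_def.1 hij)
    induction k generalizing j with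
    | zero =>
      obtain rfl : j = i := Fin.ext (by omega)
      simp
    | succ k ih =>
      have h2 := j.2
      have h3 := ih ⟨i + k, by omega⟩ (Fin.le_def.2 (by simp)) (by simp)
      have h4 : α j < α ⟨i + k, by omega⟩ := hα (Fin.lt_def.2 (by simp; omega))
      simp only at h3
      omega
  have h2 : ∀ i, stair N i ≤ α i := by
    intro i
    have h3 := i.2
    have h4 := h1 i ⟨N - 1, by omega⟩ (Fin.le_def.2 (by simp; omega))
    simp only at h4
    unfold stair
    omega
  refine ⟨fun i => α i - stair N i, fun i j hij => ?_, funext fun i => ?_⟩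
  · have h3 := h1 i j hij
    have h4 := h2 i
    have h5 := h2 j
    have h6 := Fin.le_def.1 hij
    have h7 := j.2
    have h8 := i.2
    simp only [stair] at *
    omega
  · exact (Nat.add_sub_cancel' (h2 i)).symm

theorem schurPoly_stair_add_const (N d : ℕ) :
    schurPoly (stair N + fun _ => d) = detPoly N ^ d := by
  have h := schurPoly_add_const (stair N) d
  rwa [schurPoly_stair, mul_one] at h

theorem star_mul_det {N : ℕ} (U : UN N) :
    (star (U : Matrix (Fin N) (Fin N) ℂ)).det * (U : Matrix (Fin N) (Fin N) ℂ).det = 1 := by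
  rw [← Matrix.det_mul, Unitary.star_mul_self_of_mem U.2, Matrix.det_one]

theorem integral_det_mul_schurPoly {N : ℕ} (μ : Measure (UN N)) [μ.IsHaarMeasure]
    [IsProbabilityMeasure μ] (d : ℕ) (α : Fin N → ℕ) :
    ∫ U : UN N, (star (U : Matrix (Fin N) (Fin N) ℂ)).det ^ d *
      evalMat (U : Matrix (Fin N) (Fin N) ℂ) (schurPoly α) ∂μ =
      (altPoly (stair N + fun _ => d)).coeff (Finsupp.equivFunOnFinite.symm α) := by
  have hd : StrictAnti (stair N + fun _ => d) := strictAnti_stair_add antitone_const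
  obtain ⟨σ, hσ⟩ := exists_antitone_comp α
  by_cases hα : Function.Injective α
  · obtain ⟨l, hl, hl'⟩ := exists_eq_stair_add (hσ.strictAnti_of_injective (hα.comp σ.injective))
    obtain rfl : α = (stair N + l) ∘ ⇑σ⁻¹ := by
      rw [← hl', Function.comp_assoc]
      simp
    rw [schurPoly_comp_perm, coeff_altPoly_comp_perm,
      coeff_altPoly_of_strictAnti hd (strictAnti_stair_add hl)]
    simp only [map_smul, smul_eq_mul, mul_left_comm _ ((Equiv.Perm.sign σ⁻¹ : ℤ) : ℂ)]
    rw [integral_const_mul]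
    congr 1
    by_cases h : l = fun _ => d
    · subst h
      simp only [if_true, schurPoly_stair_add_const, map_pow, evalMat_detPoly, ← mul_pow,
        star_mul_det, one_pow]
      simp
    · rw [if_neg (by simpa using h)]
      have := integral_schurPoly_mul_of_ne μ hl (m := fun _ => d) antitone_const h 1
      simpa only [schurPoly_stair_add_const, map_pow, evalMat_detPoly, one_mul] using this
  · rw [schurPoly_eq_zero hα, coeff_altPoly_eq_zero hd.injective hα]
    simp

/-- The substitution `X ↦ adj X`. -/
def adjHom (N : ℕ) : MatPoly N →ₐ[ℂ] MatPoly N :=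
  MvPolynomial.aeval fun p => (genMat N).adjugate p.1 p.2

theorem evalMat_adjHom {N : ℕ} (X : Matrix (Fin N) (Fin N) ℂ) (f : MatPoly N) :
    evalMat X (adjHom N f) = evalMat X.adjugate f := by
  have h : ((genMat N).adjugate).map (evalMat X) = X.adjugate := by
    conv_rhs => rw [← map_genMat X]
    exact AlgHom.map_adjugate (evalMat X) (genMat N)
  have : (evalMat X).comp (adjHom N) = evalMat X.adjugate := by
    refine MvPolynomial.algHom_ext fun p => ?_
    rw [AlgHom.comp_apply, adjHom, MvPolynomial.aeval_X, evalMat_X, ← h, Matrix.map_apply]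
  rw [← this, AlgHom.comp_apply]

theorem adjugate_unitary {N : ℕ} (U : UN N) :
    (U : Matrix (Fin N) (Fin N) ℂ).adjugate =
      (U : Matrix (Fin N) (Fin N) ℂ).det • star (U : Matrix (Fin N) (Fin N) ℂ) := by
  have h := congrArg (star (U : Matrix (Fin N) (Fin N) ℂ) * ·)
    (Matrix.mul_adjugate (U : Matrix (Fin N) (Fin N) ℂ))
  simpa only [← mul_assoc, Unitary.star_mul_self_of_mem U.2, one_mul, Matrix.mul_smul,
    mul_one] using h

theorem IsClass.adjHom {N : ℕ} {f : MatPoly N} (hf : IsClass f) : IsClass (adjHom N f) := by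
  intro U X
  have h := adjugate_unitary (star U)
  rw [Unitary.coe_star, star_star] at h
  rw [evalMat_adjHom, evalMat_adjHom, Matrix.adjugate_mul_distrib, Matrix.adjugate_mul_distrib,
    adjugate_unitary, h, Matrix.mul_smul, Matrix.mul_smul, Matrix.smul_mul, smul_smul,
    star_mul_det, one_smul, ← mul_assoc, hf U]

theorem evalMat_smul {N n : ℕ} {f : MatPoly N} (hf : f.IsHomogeneous n) (c : ℂ)
    (X : Matrix (Fin N) (Fin N) ℂ) : evalMat (c • X) f = c ^ n * evalMat X f := by
  rw [f.as_sum, map_sum, map_sum, Finset.mul_sum]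
  refine Finset.sum_congr rfl fun β hβ => ?_
  have h : β.degree = n := by
    by_contra h
    exact MvPolynomial.mem_support_iff.1 hβ (hf.coeff_eq_zero h)
  simp only [evalMat, MvPolynomial.aeval_monomial, Finsupp.prod, Matrix.smul_apply, smul_eq_mul,
    mul_pow, Finset.prod_mul_distrib, Finset.prod_pow_eq_pow_sum]
  have h1 : β.degree = ∑ i ∈ β.support, β i := rfl
  rw [← h, h1, mul_left_comm]

theorem evalMat_star {N n : ℕ} {f : MatPoly N} (hf : f.IsHomogeneous n) (U : UN N) :
    evalMat (star (U : Matrix (Fin N) (Fin N) ℂ)) f =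
      (star (U : Matrix (Fin N) (Fin N) ℂ)).det ^ n *
        evalMat (U : Matrix (Fin N) (Fin N) ℂ) (adjHom N f) := by
  rw [evalMat_adjHom, adjugate_unitary, evalMat_smul hf, ← mul_assoc, ← mul_pow, star_mul_det,
    one_pow, one_mul]

/-- The substitution `x_i ↦ ∏_{j ≠ i} x_j`. -/
def coprodHom (N : ℕ) : MvPolynomial (Fin N) ℂ →ₐ[ℂ] MvPolynomial (Fin N) ℂ :=
  MvPolynomial.aeval fun i => ∏ j ∈ Finset.univ.erase i, MvPolynomial.X j

theorem diagRes_adjHom {N : ℕ} (f : MatPoly N) :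
    diagRes N (adjHom N f) = coprodHom N (diagRes N f) := by
  have h1 : (genMat N).map (diagRes N) = Matrix.diagonal MvPolynomial.X := by
    ext1 a b
    simp [genMat_apply, diagRes, Matrix.diagonal_apply]
  have h2 : ((genMat N).adjugate).map (diagRes N) =
      Matrix.diagonal fun i => ∏ j ∈ Finset.univ.erase i, MvPolynomial.X j := by
    rw [← Matrix.adjugate_diagonal, ← h1]
    exact AlgHom.map_adjugate (diagRes N) (genMat N)
  have : (diagRes N).comp (adjHom N) = (coprodHom N).comp (diagRes N) := by
    refine MvPolynomial.algHom_ext fun p => ?_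
    rw [AlgHom.comp_apply, adjHom, MvPolynomial.aeval_X, AlgHom.comp_apply, ← Matrix.map_apply
      (f := diagRes N), h2, diagRes, MvPolynomial.aeval_X, Matrix.diagonal_apply]
    split_ifs
    · rw [coprodHom, MvPolynomial.aeval_X]
    · rw [map_zero]
  exact DFunLike.congr_fun this f

theorem coprodHom_expMonomial {N : ℕ} (γ : Fin N → ℕ) :
    coprodHom N (expMonomial γ) = expMonomial fun j => ∑ i ∈ Finset.univ.erase j, γ i := by
  rw [expMonomial_eq_prod, expMonomial_eq_prod, map_prod]
  simp only [map_pow, coprodHom, MvPolynomial.aeval_X, ← Finset.prod_pow,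
    ← Finset.prod_pow_eq_pow_sum]
  exact Finset.prod_comm' (by simp [eq_comm])

theorem isHomogeneous_diagRes {N n : ℕ} {f : MatPoly N} (hf : f.IsHomogeneous n) :
    (diagRes N f).IsHomogeneous n := by
  have h := hf.aeval (S := ℂ) (τ := Fin N) (n := 1)
    (fun p => if p.1 = p.2 then MvPolynomial.X p.1 else 0) fun p => by
      split_ifs
      · exact MvPolynomial.isHomogeneous_X _ _
      · exact MvPolynomial.isHomogeneous_zero _ _ _
  rwa [one_mul] at h

/-- Orthonormality of Schur polynomials. -/
theorem integral_schurPoly_mul_self {N : ℕ} (μ : Measure (UN N)) [μ.IsHaarMeasure]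
    [IsProbabilityMeasure μ] {l : Fin N → ℕ} (hl : Antitone l) :
    ∫ U : UN N, evalMat (star (U : Matrix (Fin N) (Fin N) ℂ)) (schurPoly (stair N + l)) *
      evalMat (U : Matrix (Fin N) (Fin N) ℂ) (schurPoly (stair N + l)) ∂μ = 1 := by
  set τ := stair N + l with hτ
  set d := ∑ i, l i with hd
  have hhom : (schurPoly τ).IsHomogeneous d := isHomogeneous_schurPoly l
  set K := diagRes N (schurPoly τ) with hK
  have hKhom : K.IsHomogeneous d := isHomogeneous_diagRes hhom
  set Q := coprodHom N K with hQ
  have hclass : IsClass (adjHom N (schurPoly τ)) := (isClass_schurPoly τ).adjHom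
  have hQsymm : Q.IsSymmetric := by
    rw [hQ, hK, ← diagRes_adjHom]
    exact hclass.isSymmetric
  have hexp : adjHom N (schurPoly τ) * schurPoly τ =
      ∑ β ∈ Q.support, Q.coeff β • schurPoly (τ + ⇑β) := by
    refine (hclass.mul (isClass_schurPoly τ)).eq_of_altPoly (isClass_of_mem_traceAlg
      (sum_mem fun β _ => Subalgebra.smul_mem _ (schurPoly_mem _) _)) ?_
    rw [map_mul, mul_left_comm, altPoly_stair_mul_diagRes_schurPoly, diagRes_adjHom,
      symmetric_mul_altPoly hQsymm, map_sum, Finset.mul_sum]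
    refine Finset.sum_congr rfl fun β _ => ?_
    rw [map_smul, mul_smul_comm, altPoly_stair_mul_diagRes_schurPoly,
      MvPolynomial.smul_eq_C_mul]
  let F : (Fin N →₀ ℕ) → ℂ := fun β => (altPoly (stair N + fun _ => d)).coeff
    (Finsupp.equivFunOnFinite.symm (τ + ⇑β))
  let Φ : MvPolynomial (Fin N) ℂ →ₗ[ℂ] ℂ := (MvPolynomial.basisMonomials (Fin N) ℂ).constr ℂ F
  have hΦ : ∀ β c, Φ (MvPolynomial.monomial β c) = c * F β := by
    intro β c
    have h := (MvPolynomial.basisMonomials (Fin N) ℂ).constr_basis ℂ F β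
    rw [MvPolynomial.coe_basisMonomials] at h
    rw [← mul_one c, ← smul_eq_mul c, ← MvPolynomial.smul_monomial, map_smul, h]
    simp
  have h1 : ∫ U : UN N, evalMat (star (U : Matrix (Fin N) (Fin N) ℂ)) (schurPoly τ) *
      evalMat (U : Matrix (Fin N) (Fin N) ℂ) (schurPoly τ) ∂μ = Φ Q := by
    simp only [evalMat_star hhom, mul_assoc, ← map_mul, hexp, map_sum, map_smul, smul_eq_mul,
      Finset.mul_sum]
    rw [integral_finsetSum _ fun β _ => integrable_of_continuous μ ?_]
    · conv_rhs => rw [Q.as_sum, map_sum]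
      refine Finset.sum_congr rfl fun β _ => ?_
      simp only [mul_left_comm _ (Q.coeff β)]
      rw [integral_const_mul, integral_det_mul_schurPoly, hΦ]
    · exact ((continuous_star_unitary.matrix_det).pow d).mul
        (continuous_const.mul (continuous_evalMat continuous_subtype_val _))
  have h2 : Φ Q = (K * altPoly (stair N)).coeff (Finsupp.equivFunOnFinite.symm τ) := by
    rw [hQ]
    conv_lhs => rw [K.as_sum]
    conv_rhs => rw [K.as_sum]
    rw [map_sum, map_sum, Finset.sum_mul, MvPolynomial.coeff_sum]
    refine Finset.sum_congr rfl fun γ hγ => ?_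
    have hγd : ∑ i, γ i = d := by
      rw [← Finsupp.degree_eq_sum]
      by_contra h
      exact MvPolynomial.mem_support_iff.1 hγ (hKhom.coeff_eq_zero h)
    have hm : MvPolynomial.monomial γ (K.coeff γ) = K.coeff γ • expMonomial ⇑γ := by
      simp [expMonomial, MvPolynomial.smul_monomial]
    rw [hm, map_smul, map_smul, smul_mul_assoc, MvPolynomial.coeff_smul, coprodHom_expMonomial]
    congr 1
    rw [expMonomial, hΦ, one_mul]
    simp only [F]
    rw [coeff_altPoly, altPoly_eq_sum, Finset.mul_sum, MvPolynomial.coeff_sum]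
    refine Finset.sum_congr rfl fun σ _ => ?_
    rw [mul_left_comm, MvPolynomial.coeff_C_mul, expMonomial_mul, expMonomial,
      MvPolynomial.coeff_monomial, mul_ite, mul_one, mul_zero]
    refine if_congr ?_ rfl rfl
    rw [Equiv.apply_eq_iff_eq]
    rw [funext_iff, funext_iff]
    refine forall_congr' fun i => ?_
    have h3 := Finset.add_sum_erase Finset.univ (fun i => γ i) (Finset.mem_univ i)
    simp only [Pi.add_apply, Function.comp_apply, Finsupp.equivFunOnFinite_symm_apply_apply]
    omega
  rw [h1, h2, mul_comm, hK, altPoly_stair_mul_diagRes_schurPoly,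
    coeff_altPoly_of_strictAnti (strictAnti_stair_add hl) (strictAnti_stair_add hl), if_pos rfl]

theorem integral_evalMat_mul_evalMat {N : ℕ} (μ : Measure (UN N)) [μ.IsHaarMeasure]
    [IsProbabilityMeasure μ] {l m : Fin N → ℕ} (hl : Antitone l) (hm : Antitone m)
    (A B : Matrix (Fin N) (Fin N) ℂ) :
    ∫ U : UN N, evalMat ((U : Matrix (Fin N) (Fin N) ℂ) * A) (schurPoly (stair N + l)) *
      evalMat (star (U : Matrix (Fin N) (Fin N) ℂ) * B) (schurPoly (stair N + m)) ∂μ =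
      if l = m then evalMat (A * B) (schurPoly (stair N + l)) /
        evalMat 1 (schurPoly (stair N + l)) else 0 := by
  obtain ⟨d, hd⟩ := exists_integral_schurPoly_mul μ hl m
  obtain ⟨T, hT⟩ := exists_average μ
    (w := fun U : UN N => evalMat ((U : Matrix (Fin N) (Fin N) ℂ) * A) (schurPoly (stair N + l)))
    (continuous_evalMat (continuous_subtype_val.mul continuous_const) _)
    (φ := fun U : UN N => star (U : Matrix (Fin N) (Fin N) ℂ)) continuous_star_unitary
  have hT' : ∀ B, evalMat B (T (schurPoly (stair N + m))) =
      ∫ U : UN N, evalMat ((U : Matrix (Fin N) (Fin N) ℂ) * A) (schurPoly (stair N + l)) *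
        evalMat (star (U : Matrix (Fin N) (Fin N) ℂ) * B) (schurPoly (stair N + m)) ∂μ := by
    intro B
    have h := hT (evalMat B).toLinearMap (schurPoly (stair N + m))
    simp only [AlgHom.toLinearMap_apply, evalMat_rightTrans] at h
    rw [h]
    simp only [evalMat_schurPoly_mul_comm _ B]
  have h1 : T (schurPoly (stair N + m)) = d • rightTrans A (schurPoly (stair N + l)) := by
    rw [← sub_eq_zero]
    refine matPoly_eq_zero_of_unitary fun V => ?_
    rw [map_sub, map_smul, hT', evalMat_rightTrans, smul_eq_mul, evalMat_schurPoly_mul_comm,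
      ← hd, ← integral_mul_left_eq_self _ V, sub_eq_zero]
    refine integral_congr_ae (Filter.Eventually.of_forall fun U => ?_)
    simp only [Submonoid.coe_mul, star_mul]
    rw [mul_assoc (star _), Unitary.star_mul_self_of_mem V.2, mul_one,
      mul_assoc (V : Matrix (Fin N) (Fin N) ℂ),
      evalMat_schurPoly_mul_comm _ (V : Matrix (Fin N) (Fin N) ℂ),
      mul_assoc (U : Matrix (Fin N) (Fin N) ℂ),
      evalMat_schurPoly_mul_comm _ (U : Matrix (Fin N) (Fin N) ℂ), mul_comm]
  rw [← hT', h1, map_smul, evalMat_rightTrans, evalMat_schurPoly_mul_comm, smul_eq_mul]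
  split_ifs with h
  · subst h
    have h2 := hd 1
    simp only [one_mul, integral_schurPoly_mul_self μ hl] at h2
    rw [eq_div_iff (right_ne_zero_of_mul_eq_one h2.symm), mul_right_comm, ← h2, one_mul]
  · rw [← hd, integral_schurPoly_mul_of_ne μ hl hm h]

/-- For `q ≥ 1` and invertible `B`:
`∫_{U(N)} s_λ(UA) s_μ(U†B) (det U)^{-q} d_*U
= δ_{λ, μ+q^N} (det B)^{-q} s_λ(AB)/s_λ(I_N)`. -/
theorem statement10 {N : ℕ} (hN : 1 ≤ N)
    (A B : Matrix (Fin N) (Fin N) ℂ) (hB : IsUnit B.det)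
    (l m : Fin N → ℕ) (hl : Antitone l) (hm : Antitone m)
    (q : ℕ) (hq : 1 ≤ q)
    (μ : Measure (UN N)) [μ.IsHaarMeasure] [IsProbabilityMeasure μ] :
    (∫ U : UN N,
        schur l ((U : Matrix (Fin N) (Fin N) ℂ) * A) * schur m (star (U : Matrix (Fin N) (Fin N) ℂ) * B) *
          ((U : Matrix (Fin N) (Fin N) ℂ).det) ^ (-(q : ℤ)) ∂μ) =
      if l = (fun i => m i + q) then
        B.det ^ (-(q : ℤ)) * (schur l (A * B) / schur l (1 : Matrix (Fin N) (Fin N) ℂ))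
      else 0 := by
  have hschur : ∀ (l : Fin N → ℕ) X, schur l X = evalMat X (schurPoly (stair N + l)) := fun l X => by
    rw [schur_eq_evalMat]
    simp only [add_comm]
    rfl
  have hm' : Antitone fun i => m i + q := fun i j h => Nat.add_le_add_right (hm h) q
  have key := congrArg (B.det ^ (-(q : ℤ)) * ·) (integral_evalMat_mul_evalMat μ hl hm' A B)
  simp only [← hschur, mul_ite, mul_zero, ← integral_const_mul] at key
  rw [← key]
  refine integral_congr_ae (Filter.Eventually.of_forall fun U => ?_)
  have h1 : schur (fun i => m i + q) (star (U : Matrix (Fin N) (Fin N) ℂ) * B) =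
      (star (U : Matrix (Fin N) (Fin N) ℂ) * B).det ^ q *
        schur m (star (U : Matrix (Fin N) (Fin N) ℂ) * B) := by
    rw [hschur, hschur, ← evalMat_detPoly, ← map_pow, ← map_mul, ← schurPoly_add_const]
    exact congrArg (fun α => evalMat _ (schurPoly α)) (funext fun i => (add_assoc _ _ _).symm)
  have h2 : (U : Matrix (Fin N) (Fin N) ℂ).det ^ (-(q : ℤ)) =
      (star (U : Matrix (Fin N) (Fin N) ℂ)).det ^ q := by
    rw [eq_inv_of_mul_eq_one_left (star_mul_det U), _root_.zpow_neg, zpow_natCast, inv_pow]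
  simp only
  rw [h1, h2, Matrix.det_mul, mul_pow, _root_.zpow_neg, zpow_natCast]
  have h3 := pow_ne_zero q hB.ne_zero
  field_simp

end
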